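/- arXiv:1202.2275 — 8 statements merged into one kernel-verified Lean document; each statement's English description precedes it below -/
import Mathlib

section
/- Let I ⊆ R be a homogeneous ideal, let F ∈ I be a nonzero homogeneous polynomial of degree d, and let G ∈ R be a homogeneous polynomial of degree a ≥ 1 such that F, G form a regular sequence in R. Set J = G·I + (F). Then the sequence of R-modules 0 → R → R ⊕ I → J → 0 is exact, where the first map sends x to (G·x, −F·x) and the second map sends (p, q) to p·F + q·G. (Taking the grading into account, this is the exact sequence 0 → R(−d−a) → R(−d) ⊕ I(−a) → J → 0 underlying the free resolution of a basic double link.) -/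
open MvPolynomial

noncomputable section

/-- The polynomial ring `K[x_0, ..., x_n]`. -/
abbrev PR (K : Type) [Field K] (n : ℕ) := MvPolynomial (Fin (n + 1)) K

/-- An ideal is homogeneous if it contains all homogeneous components of its elements. -/
def IsHomogIdeal {K : Type} [Field K] {n : ℕ} (I : Ideal (PR K n)) : Prop :=
  ∀ F ∈ I, ∀ d : ℕ, homogeneousComponent d F ∈ I

/-- `F, G` is a regular sequence in `R`: `F` is a nonzerodivisor on `R` and `G` is a
nonzerodivisor on `R/(F)`. -/
def IsRegSeq {K : Type} [Field K] {n : ℕ} (F G : PR K n) : Prop :=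
  IsSMulRegular (PR K n) F ∧
    IsSMulRegular ((PR K n) ⧸ Ideal.span {F}) (Ideal.Quotient.mk (Ideal.span {F}) G)

/-- The height of an ideal: the infimum of the heights of the primes containing it. -/
def idealHeight {A : Type} [CommRing A] (I : Ideal A) : ℕ∞ :=
  ⨅ (P : PrimeSpectrum A) (_ : I ≤ P.asIdeal), Order.height P

/-- The Hilbert function of `R/I`: `h_{R/I}(t) = dim_K R_t - dim_K (I ∩ R_t)`. -/
def hilbQuot {K : Type} [Field K] {n : ℕ} (I : Ideal (PR K n)) (t : ℤ) : ℤ :=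
  if t < 0 then 0 else
    (Module.finrank K (homogeneousSubmodule (Fin (n + 1)) K t.toNat) : ℤ) -
      (Module.finrank K
        ((Submodule.restrictScalars K I) ⊓ homogeneousSubmodule (Fin (n + 1)) K t.toNat :
          Submodule K (PR K n)) : ℤ)

/-- The Hilbert function of the polynomial ring in `n+1` variables. -/
def hPoly (n : ℕ) (k : ℤ) : ℤ := if k < 0 then 0 else (Nat.choose (n + k.toNat) n : ℤ)

/-- The ideal `J` has a free resolution `0 → A^p → A^q → J → 0`. -/
def HasLen1FreeRes {A : Type} [CommRing A] (J : Ideal A) : Prop :=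
  ∃ (p q : ℕ) (f : (Fin p → A) →ₗ[A] (Fin q → A)) (g : (Fin q → A) →ₗ[A] A),
    Function.Injective f ∧ LinearMap.ker g = LinearMap.range f ∧ LinearMap.range g = J

/-- `J` is numerically ACM: some proper homogeneous ideal `J'` of height 2 with `R/J'`
Cohen-Macaulay (equivalently, of projective dimension 2) has the same Hilbert function. -/
def NumACM {K : Type} [Field K] {n : ℕ} (J : Ideal (PR K n)) : Prop :=
  ∃ J' : Ideal (PR K n), J' ≠ ⊤ ∧ IsHomogIdeal J' ∧ idealHeight J' = 2 ∧
    HasLen1FreeRes J' ∧ ∀ t : ℤ, hilbQuot J' t = hilbQuot J t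

/-- `J` is a basic double link of `I` of type `(d, a)`. -/
def IsBDL {K : Type} [Field K] {n : ℕ} (I J : Ideal (PR K n)) (d a : ℕ) : Prop :=
  ∃ F G : PR K n, F ∈ I ∧ F ≠ 0 ∧ F.IsHomogeneous d ∧ 1 ≤ a ∧ G.IsHomogeneous a ∧
    IsRegSeq F G ∧ J = Ideal.span {G} * I + Ideal.span {F}

/-- The first map `R → R ⊕ I`, `x ↦ (G·x, -F·x)`. -/
def bdlα {K : Type} [Field K] {n : ℕ} (I : Ideal (PR K n)) (F G : PR K n) (hF : F ∈ I) :
    PR K n →ₗ[PR K n] (PR K n) × I :=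
  (LinearMap.mulLeft (PR K n) G).prod
    (LinearMap.codRestrict I (LinearMap.mulLeft (PR K n) (-F))
      (fun x => I.mul_mem_right x (I.neg_mem hF)))

/-- The second map `R ⊕ I → R`, `(p, q) ↦ p·F + q·G`. -/
def bdlβ {K : Type} [Field K] {n : ℕ} (I : Ideal (PR K n)) (F G : PR K n) :
    (PR K n) × I →ₗ[PR K n] PR K n :=
  (LinearMap.mulLeft (PR K n) F).comp (LinearMap.fst _ _ _) +
    (LinearMap.mulLeft (PR K n) G).comp (I.subtype.comp (LinearMap.snd _ _ _))
/-- The finite difference operator `(Δf)(k) = f(k) - f(k-1)`. -/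
def deltaOp (f : ℤ → ℤ) : ℤ → ℤ := fun k => f k - f (k - 1)

/-- The number of minimal generators of `I` in degree `d`, i.e. the `K`-dimension of the
degree-`d` component of `I/𝔪I`, computed as `dim_K (I ∩ R_d) - dim_K (𝔪I ∩ R_d)`. -/
def minGensDeg {K : Type} [Field K] {n : ℕ} (I : Ideal (PR K n)) (d : ℕ) : ℤ :=
  (Module.finrank K
      ((Submodule.restrictScalars K I) ⊓ homogeneousSubmodule (Fin (n + 1)) K d :
        Submodule K (PR K n)) : ℤ) -
    (Module.finrank K
      ((Submodule.restrictScalars K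
          (Ideal.span (Set.range (X : Fin (n + 1) → PR K n)) * I)) ⊓
          homogeneousSubmodule (Fin (n + 1)) K d :
        Submodule K (PR K n)) : ℤ)

/-- The ideal `I` is saturated with respect to `𝔪 = (x_0, ..., x_n)`. -/
def IsSatIdeal {K : Type} [Field K] {n : ℕ} (I : Ideal (PR K n)) : Prop :=
  ∀ x : PR K n,
    (∃ k : ℕ, ∀ y ∈ (Ideal.span (Set.range (X : Fin (n + 1) → PR K n))) ^ k, x * y ∈ I) →
      x ∈ I

theorem stmt0 {K : Type} [Field K] [Infinite K] {n : ℕ} (hn : 2 ≤ n)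
    (I : Ideal (PR K n)) (hI : IsHomogIdeal I)
    (F G : PR K n) (d a : ℕ)
    (hFI : F ∈ I) (hF0 : F ≠ 0) (hFd : F.IsHomogeneous d)
    (ha : 1 ≤ a) (hGa : G.IsHomogeneous a) (hreg : IsRegSeq F G) :
    Function.Injective (bdlα I F G hFI) ∧
      LinearMap.ker (bdlβ I F G) = LinearMap.range (bdlα I F G hFI) ∧
      LinearMap.range (bdlβ I F G) = Ideal.span {G} * I + Ideal.span {F} := by
  have hker : ∀ p q : PR K n, F * p + G * q = 0 → ∃ x, G * x = p ∧ -F * x = q := by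
    intro p q h
    have hq : Ideal.Quotient.mk (Ideal.span {F}) q = 0 := by
      refine hreg.2.right_eq_zero_of_smul ?_
      rw [smul_eq_mul, ← map_mul, Ideal.Quotient.eq_zero_iff_mem, Ideal.mem_span_singleton]
      exact ⟨-p, by linear_combination h⟩
    rw [Ideal.Quotient.eq_zero_iff_mem, Ideal.mem_span_singleton] at hq
    obtain ⟨r, rfl⟩ := hq
    refine ⟨-r, mul_left_cancel₀ hF0 ?_, by ring⟩
    linear_combination -h
  refine ⟨?_, ?_, ?_⟩
  · intro x y hxy
    have h : -F * x = -F * y := congrArg (fun z => (z.2 : PR K n)) hxy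
    exact mul_left_cancel₀ (neg_ne_zero.mpr hF0) h
  · ext ⟨p, q, hq⟩
    constructor
    · intro h
      obtain ⟨x, hp, hx⟩ := hker p q h
      exact ⟨x, Prod.ext hp (Subtype.ext hx)⟩
    · rintro ⟨x, hx⟩
      rw [← hx]
      change F * (G * x) + G * (-F * x) = 0
      ring
  · ext z
    rw [Submodule.add_eq_sup, Submodule.mem_sup]
    constructor
    · rintro ⟨⟨p, q⟩, rfl⟩
      exact ⟨G * q, Ideal.mul_mem_mul (Ideal.mem_span_singleton_self G) q.2, F * p,
        Ideal.mul_mem_right _ _ (Ideal.mem_span_singleton_self F), add_comm _ _⟩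
    · rintro ⟨u, hu, v, hv, rfl⟩
      obtain ⟨q, hq, rfl⟩ := Ideal.mem_span_singleton_mul.mp hu
      obtain ⟨p, rfl⟩ := Ideal.mem_span_singleton.mp hv
      exact ⟨(p, ⟨q, hq⟩), add_comm _ _⟩
end
end

section
/- Let I ⊆ R be a proper homogeneous ideal of height at least 2, and let J = G·I + (F) be a basic double link of I of type (d,a). Then for every integer t, the Hilbert functions satisfy h_{R/J}(t) = h_{R/I}(t − a) + h_{R/(F,G)}(t), where (F,G) is the complete intersection ideal generated by F and G. -/
open MvPolynomial

noncomputable section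

section HomogeneousMul

attribute [local instance] MvPolynomial.gradedAlgebra

theorem homogeneousComponent_isHomogeneous_mul_of_le {σ R : Type*} [CommSemiring R]
    {G : MvPolynomial σ R} {a m : ℕ} (hG : G.IsHomogeneous a) (h : a ≤ m) (r : MvPolynomial σ R) :
    homogeneousComponent m (G * r) = G * homogeneousComponent (m - a) r :=
  (decomposition.decompose'_apply (R := R) _ m).symm.trans <|
    DirectSum.coe_decompose_mul_of_left_mem_of_le (homogeneousSubmodule σ R) hG h |>.trans <|
      congrArg (G * ·) (decomposition.decompose'_apply r (m - a))

theorem homogeneousComponent_isHomogeneous_mul_of_lt {σ R : Type*} [CommSemiring R]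
    {G : MvPolynomial σ R} {a m : ℕ} (hG : G.IsHomogeneous a) (h : m < a) (r : MvPolynomial σ R) :
    homogeneousComponent m (G * r) = 0 :=
  (decomposition.decompose'_apply (R := R) _ m).symm.trans <|
    DirectSum.coe_decompose_mul_of_left_mem_of_not_le (homogeneousSubmodule σ R) hG h.not_ge

end HomogeneousMul

theorem homogeneousComponent_isHomogeneous_mul_mem {σ R : Type*} [CommSemiring R]
    {F : MvPolynomial σ R} {d : ℕ} (hF : F.IsHomogeneous d) (m : ℕ) (s : MvPolynomial σ R) :
    homogeneousComponent m (F * s) ∈ Ideal.span {F} := by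
  rcases lt_or_ge m d with h | h
  · rw [homogeneousComponent_isHomogeneous_mul_of_lt hF h]
    exact zero_mem _
  · rw [homogeneousComponent_isHomogeneous_mul_of_le hF h]
    exact Ideal.mul_mem_right _ _ (Ideal.mem_span_singleton_self F)

/-- The degree `m` part of an ideal, as a `K`-subspace. -/
abbrev gradedPiece {K : Type} [Field K] {n : ℕ} (I : Ideal (PR K n)) (m : ℕ) :
    Submodule K (PR K n) :=
  Submodule.restrictScalars K I ⊓ homogeneousSubmodule (Fin (n + 1)) K m

theorem hilbQuot_natCast {K : Type} [Field K] {n : ℕ} (I : Ideal (PR K n)) (m : ℕ) :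
    hilbQuot I m = (Module.finrank K (homogeneousSubmodule (Fin (n + 1)) K m) : ℤ) -
      Module.finrank K (gradedPiece I m) :=
  if_neg (by omega)

theorem hilbQuot_of_neg {K : Type} [Field K] {n : ℕ} (I : Ideal (PR K n)) {t : ℤ} (ht : t < 0) :
    hilbQuot I t = 0 :=
  if_pos ht

instance finiteDimensional_homogeneousSubmodule {K : Type} [Field K] {n m : ℕ} :
    FiniteDimensional K (homogeneousSubmodule (Fin (n + 1)) K m) :=
  Module.Finite.iff_fg.mpr (homogeneousSubmodule_fg _ _ m)

theorem mem_span_singleton_mul_sup_iff {A : Type*} [CommRing A] {I : Ideal A} {F G x : A} :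
    x ∈ Ideal.span {G} * I + Ideal.span {F} ↔ ∃ i ∈ I, ∃ s, G * i + F * s = x := by
  simp only [Submodule.add_eq_sup, Submodule.mem_sup, Ideal.mem_span_singleton_mul,
    Ideal.mem_span_singleton', exists_exists_and_eq_and, exists_exists_eq_and, mul_comm F]

/-- If `G` is regular modulo `F ∈ I`, then `G * r ∈ G * I + (F)` only for `r ∈ I`. -/
theorem mul_mem_span_mul_sup_iff {A : Type*} [CommRing A] {I : Ideal A} {F G : A} (hF : F ∈ I)
    (hG : IsSMulRegular (A ⧸ Ideal.span {F}) (Ideal.Quotient.mk (Ideal.span {F}) G)) {r : A} :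
    G * r ∈ Ideal.span {G} * I + Ideal.span {F} ↔ r ∈ I := by
  rw [mem_span_singleton_mul_sup_iff]
  refine ⟨fun ⟨i, hi, s, h⟩ => ?_, fun hr => ⟨r, hr, 0, by ring⟩⟩
  have hri : r - i ∈ Ideal.span {F} := by
    rw [← Ideal.Quotient.eq]
    refine hG ?_
    change Ideal.Quotient.mk _ G * Ideal.Quotient.mk _ r =
      Ideal.Quotient.mk _ G * Ideal.Quotient.mk _ i
    rw [← map_mul, ← map_mul, Ideal.Quotient.eq, ← h, add_sub_cancel_left]
    exact Ideal.mul_mem_right _ _ (Ideal.mem_span_singleton_self F)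
  have := I.add_mem ((Ideal.span_singleton_le_iff_mem I).mpr hF hri) hi
  rwa [sub_add_cancel] at this

theorem span_mul_sup_le_span_pair {A : Type*} [CommRing A] (I : Ideal A) (F G : A) :
    Ideal.span {G} * I + Ideal.span {F} ≤ Ideal.span {F, G} := by
  rw [Submodule.add_eq_sup, sup_le_iff]
  have hF : F ∈ Ideal.span {F, G} := Ideal.subset_span (by simp)
  have hG : G ∈ Ideal.span {F, G} := Ideal.subset_span (by simp)
  exact ⟨Ideal.mul_le_left.trans ((Ideal.span_singleton_le_iff_mem _).mpr hG),
    (Ideal.span_singleton_le_iff_mem _).mpr hF⟩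

section BasicDoubleLink

variable {K : Type} [Field K] {n : ℕ} {I : Ideal (PR K n)} {F G : PR K n} {d a : ℕ}

/-- An element of degree `m` in `(F, G)` is congruent modulo `F` to the degree `m` part of a
multiple of `G`. -/
theorem exists_sub_homogeneousComponent_mul_mem (hF : F.IsHomogeneous d) {m : ℕ} {x : PR K n}
    (hx : x ∈ gradedPiece (Ideal.span {F, G}) m) :
    ∃ r, x - homogeneousComponent m (G * r) ∈ Ideal.span {F} := by
  obtain ⟨hxC, hxm⟩ := hx
  obtain ⟨s, r, rfl⟩ := Ideal.mem_span_pair.mp hxC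
  refine ⟨r, ?_⟩
  rw [← homogeneousComponent_eq_self hxm, map_add, mul_comm r G, add_sub_cancel_right, mul_comm s]
  exact homogeneousComponent_isHomogeneous_mul_mem hF m s

theorem gradedPiece_basicDoubleLink_of_lt (hF : F.IsHomogeneous d) (hG : G.IsHomogeneous a)
    {m : ℕ} (hm : m < a) :
    gradedPiece (Ideal.span {G} * I + Ideal.span {F}) m = gradedPiece (Ideal.span {F, G}) m := by
  refine le_antisymm (inf_le_inf_right _ (span_mul_sup_le_span_pair I F G)) fun x hx => ?_
  obtain ⟨r, hr⟩ := exists_sub_homogeneousComponent_mul_mem hF hx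
  rw [homogeneousComponent_isHomogeneous_mul_of_lt hG hm, sub_zero] at hr
  exact ⟨le_sup_right (a := Ideal.span {G} * I) hr, hx.2⟩

theorem gradedPiece_basicDoubleLink_sup (hF : F.IsHomogeneous d) (hG : G.IsHomogeneous a) (k : ℕ) :
    gradedPiece (Ideal.span {G} * I + Ideal.span {F}) (a + k) ⊔
        (homogeneousSubmodule (Fin (n + 1)) K k).map (LinearMap.mulLeft K G) =
      gradedPiece (Ideal.span {F, G}) (a + k) := by
  have hmul : (homogeneousSubmodule (Fin (n + 1)) K k).map (LinearMap.mulLeft K G) ≤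
      gradedPiece (Ideal.span {F, G}) (a + k) := by
    rintro _ ⟨r, hr, rfl⟩
    exact ⟨Ideal.mul_mem_right _ _ (Ideal.subset_span (by simp)), hG.mul hr⟩
  refine le_antisymm (sup_le (inf_le_inf_right _ (span_mul_sup_le_span_pair I F G)) hmul)
    fun x hx => ?_
  obtain ⟨r, hr⟩ := exists_sub_homogeneousComponent_mul_mem hF hx
  rw [homogeneousComponent_isHomogeneous_mul_of_le hG (Nat.le_add_right a k),
    Nat.add_sub_cancel_left] at hr
  have hr' := homogeneousComponent_isHomogeneous k r
  exact Submodule.mem_sup.mpr ⟨_, ⟨le_sup_right (a := Ideal.span {G} * I) hr,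
    hx.2.sub (hG.mul hr')⟩, _, ⟨_, hr', rfl⟩, sub_add_cancel _ _⟩

theorem gradedPiece_basicDoubleLink_inf (hF : F ∈ I) (hG : G.IsHomogeneous a)
    (hreg : IsSMulRegular (PR K n ⧸ Ideal.span {F}) (Ideal.Quotient.mk (Ideal.span {F}) G))
    (k : ℕ) :
    gradedPiece (Ideal.span {G} * I + Ideal.span {F}) (a + k) ⊓
        (homogeneousSubmodule (Fin (n + 1)) K k).map (LinearMap.mulLeft K G) =
      (gradedPiece I k).map (LinearMap.mulLeft K G) := by
  apply le_antisymm
  · rintro _ ⟨⟨hJ, -⟩, r, hr, rfl⟩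
    exact ⟨r, ⟨(mul_mem_span_mul_sup_iff hF hreg).mp hJ, hr⟩, rfl⟩
  · rintro _ ⟨r, ⟨hrI, hr⟩, rfl⟩
    exact ⟨⟨(mul_mem_span_mul_sup_iff hF hreg).mpr hrI, hG.mul hr⟩, r, hr, rfl⟩

theorem finrank_map_mulLeft (hG : G ≠ 0) (S : Submodule K (PR K n)) :
    Module.finrank K (S.map (LinearMap.mulLeft K G)) = Module.finrank K S :=
  (Submodule.equivMapOfInjective _ (mul_right_injective₀ hG) S).finrank_eq.symm

theorem finrank_gradedPiece_basicDoubleLink (hFI : F ∈ I) (hF : F.IsHomogeneous d)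
    (hG : G.IsHomogeneous a) (hG0 : G ≠ 0)
    (hreg : IsSMulRegular (PR K n ⧸ Ideal.span {F}) (Ideal.Quotient.mk (Ideal.span {F}) G))
    (k : ℕ) :
    Module.finrank K (gradedPiece (Ideal.span {F, G}) (a + k)) +
        Module.finrank K (gradedPiece I k) =
      Module.finrank K (gradedPiece (Ideal.span {G} * I + Ideal.span {F}) (a + k)) +
        Module.finrank K (homogeneousSubmodule (Fin (n + 1)) K k) := by
  have key := Submodule.finrank_sup_add_finrank_inf_eq
    (gradedPiece (Ideal.span {G} * I + Ideal.span {F}) (a + k))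
    ((homogeneousSubmodule (Fin (n + 1)) K k).map (LinearMap.mulLeft K G))
  rw [gradedPiece_basicDoubleLink_sup hF hG, gradedPiece_basicDoubleLink_inf hFI hG hreg,
    finrank_map_mulLeft hG0, finrank_map_mulLeft hG0] at key
  exact key

end BasicDoubleLink

theorem ne_zero_of_isSMulRegular_quotient {A : Type*} [CommRing A] {I : Ideal A} (hI : I ≠ ⊤)
    {G : A} (hG : IsSMulRegular (A ⧸ I) (Ideal.Quotient.mk I G)) : G ≠ 0 := by
  have := Ideal.Quotient.nontrivial_iff.mpr hI
  rintro rfl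
  rw [map_zero] at hG
  exact hG.not_zero

theorem stmt2 {K : Type} [Field K] [Infinite K] {n : ℕ} (hn : 2 ≤ n)
    (I : Ideal (PR K n)) (hI : IsHomogIdeal I) (hIp : I ≠ ⊤) (hht : 2 ≤ idealHeight I)
    (F G : PR K n) (d a : ℕ)
    (hFI : F ∈ I) (hF0 : F ≠ 0) (hFd : F.IsHomogeneous d)
    (ha : 1 ≤ a) (hGa : G.IsHomogeneous a) (hreg : IsRegSeq F G) :
    ∀ t : ℤ, hilbQuot (Ideal.span {G} * I + Ideal.span {F}) t
      = hilbQuot I (t - a) + hilbQuot (Ideal.span {F, G}) t := by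
  intro t
  have hG0 : G ≠ 0 := ne_zero_of_isSMulRegular_quotient
    (ne_top_of_le_ne_top hIp ((Ideal.span_singleton_le_iff_mem I).mpr hFI)) hreg.2
  rcases lt_or_ge t 0 with ht | ht
  · simp only [hilbQuot_of_neg _ ht, hilbQuot_of_neg I (t := t - a) (by omega), add_zero]
  lift t to ℕ using ht
  rcases lt_or_ge t a with hta | hta
  · rw [hilbQuot_of_neg I (by omega), hilbQuot_natCast, hilbQuot_natCast, zero_add,
      gradedPiece_basicDoubleLink_of_lt hFd hGa hta]
  obtain ⟨k, rfl⟩ := Nat.exists_eq_add_of_le hta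
  have key := finrank_gradedPiece_basicDoubleLink hFI hFd hGa hG0 hreg.2 k
  rw [show ((a + k : ℕ) : ℤ) - a = k by push_cast; ring, hilbQuot_natCast, hilbQuot_natCast,
    hilbQuot_natCast]
  omega
end
end

section
/- Let I ⊆ R be a proper homogeneous ideal of height at least 2, and let J = G·I + (F) be a basic double link of I of type (d,a). Then for every integer i with 0 ≤ i ≤ n−2 there is an isomorphism of R-modules H^i_𝔪(R/J) ≅ H^i_𝔪(R/I) between the local cohomology modules with support in 𝔪 (as graded modules this isomorphism shifts degrees, namely H^i_𝔪(R/J) ≅ H^i_𝔪(R/I)(−a)). -/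
open MvPolynomial

noncomputable section

namespace BasicDoubleLink

open CategoryTheory Limits Opposite
universe u v w

section ExtLES
variable {R : Type*} [Ring R] {C : Type*} [Category* C] [Abelian C] [Linear R C]

variable (R) in
lemma shortExact_map_linearCoyoneda (P : C) [Projective P] {S : ShortComplex C}
    (hS : S.ShortExact) : (S.map ((linearCoyoneda R C).obj (op P))).ShortExact := by
  have := hS.mono_f
  have := hS.epi_g
  have h₁ : Mono (S.map ((linearCoyoneda R C).obj (op P))).f :=
    (ModuleCat.mono_iff_injective _).2 fun (a : P ⟶ S.X₁) (b : P ⟶ S.X₁)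
      (h : a ≫ S.f = b ≫ S.f) => (cancel_mono S.f).1 h
  have h₂ : Epi (S.map ((linearCoyoneda R C).obj (op P))).g :=
    (ModuleCat.epi_iff_surjective _).2 fun (a : P ⟶ S.X₃) =>
      ⟨Projective.factorThru a S.g, Projective.factorThru_comp a S.g⟩
  exact
    { exact := (ShortComplex.moduleCat_exact_iff _).2 fun (a : P ⟶ S.X₂) (h : a ≫ S.g = 0) =>
        ⟨hS.exact.lift a h, hS.exact.lift_f a h⟩ }

variable (R) in
/-- The short complex `Hom(K, S.X₃) ⟶ Hom(K, S.X₂) ⟶ Hom(K, S.X₁)` of chain complexes in the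
opposite category of modules. -/
def homShortComplex (K : ChainComplex C ℕ) (S : ShortComplex C) :
    ShortComplex (ChainComplex (ModuleCat R)ᵒᵖ ℕ) where
  f := (NatTrans.mapHomologicalComplex (NatTrans.rightOp ((linearYoneda R C).map S.g)) _).app K
  g := (NatTrans.mapHomologicalComplex (NatTrans.rightOp ((linearYoneda R C).map S.f)) _).app K
  zero := by
    ext i
    apply Quiver.Hom.unop_inj
    ext (a : K.X i ⟶ S.X₁)
    change (a ≫ S.f) ≫ S.g = 0
    simp

lemma homShortComplex_shortExact (K : ChainComplex C ℕ) [∀ i, Projective (K.X i)]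
    {S : ShortComplex C} (hS : S.ShortExact) : (homShortComplex R K S).ShortExact :=
  HomologicalComplex.shortExact_of_degreewise_shortExact _ fun i =>
    (shortExact_map_linearCoyoneda R (K.X i) hS).op

variable [EnoughProjectives C]

lemma isZero_homShortComplex_homology {X : C} (P : ProjectiveResolution X) (S : ShortComplex C)
    (i : ℕ) (h : IsZero (((Ext R C i).obj (op X)).obj S.X₃)) :
    IsZero ((homShortComplex R P.complex S).X₁.homology i) :=
  h.op.of_iso (P.isoLeftDerivedObj ((linearYoneda R C).obj S.X₃).rightOp i).symm

lemma isIso_ext_map {S : ShortComplex C} (hS : S.ShortExact) (X : C) (i : ℕ)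
    (h : ∀ j ≤ i, IsZero (((Ext R C j).obj (op X)).obj S.X₃)) :
    IsIso (((Ext R C i).obj (op X)).map S.f) := by
  let P := projectiveResolution X
  have hT := homShortComplex_shortExact (R := R) P.complex hS
  have := hT.epi_g
  have hm : Mono (HomologicalComplex.homologyMap (homShortComplex R P.complex S).g i) :=
    (hT.homology_exact₂ i).mono_g
      ((isZero_homShortComplex_homology P S i (h i le_rfl)).eq_of_src _ _)
  have he : Epi (HomologicalComplex.homologyMap (homShortComplex R P.complex S).g i) := by
    cases i with
    | zero => exact HomologicalComplex.epi_homologyMap_of_epi_of_not_rel _ _ (by simp)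
    | succ i =>
      exact (hT.homology_exact₃ (i + 1) i (by simp)).epi_f
        ((isZero_homShortComplex_homology P S i (h i (by omega))).eq_of_tgt _ _)
  have hi : IsIso (HomologicalComplex.homologyMap (homShortComplex R P.complex S).g i) :=
    isIso_of_mono_of_epi _
  have key := P.leftDerived_app_eq (NatTrans.rightOp ((linearYoneda R C).map S.f)) i
  have : IsIso ((NatTrans.leftDerived
      (NatTrans.rightOp ((linearYoneda R C).map S.f)) i).app X) := by
    rw [key]
    have : IsIso ((HomologicalComplex.homologyFunctor (ModuleCat R)ᵒᵖ (ComplexShape.down ℕ) i).map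
      ((NatTrans.mapHomologicalComplex
        (NatTrans.rightOp ((linearYoneda R C).map S.f)) _).app P.complex)) := hi
    infer_instance
  exact inferInstanceAs (IsIso (((NatTrans.leftDerived
      (NatTrans.rightOp ((linearYoneda R C).map S.f)) i).app X).unop))

lemma isZero_ext_of_subsingleton [HasExt.{w} C] (X Y : C) (i : ℕ)
    [Subsingleton (Abelian.Ext X Y i)] : IsZero (((Ext R C i).obj (op X)).obj Y) := by
  let P := projectiveResolution X
  refine IsZero.of_iso ?_ (P.isoExt i Y)
  rw [← HomologicalComplex.exactAt_iff_isZero_homology]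
  cases i with
  | zero =>
    rw [HomologicalComplex.exactAt_iff' _ 0 0 1 (by simp) (by simp),
      ShortComplex.moduleCat_exact_iff]
    intro (f : P.complex.X 0 ⟶ Y) (hf : P.complex.d 1 0 ≫ f = 0)
    have : Subsingleton (X ⟶ Y) := Abelian.Ext.addEquiv₀.symm.subsingleton
    obtain ⟨l, hl⟩ := CokernelCofork.IsColimit.desc' P.isColimitCokernelCofork f hf
    have hl₀ : l = 0 := Subsingleton.elim (α := X ⟶ Y) l 0
    exact ⟨0, (map_zero _).trans (by rw [← hl, hl₀, comp_zero]; rfl)⟩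
  | succ i =>
    rw [HomologicalComplex.exactAt_iff' _ i (i + 1) (i + 2) (by simp) (by simp),
      ShortComplex.moduleCat_exact_iff]
    intro (f : P.complex.X (i + 1) ⟶ Y) (hf : P.complex.d (i + 2) (i + 1) ≫ f = 0)
    exact (P.extMk_eq_zero_iff f (i + 2) rfl hf i rfl).1 (Subsingleton.elim _ _)

end ExtLES

section LocalCohomology
variable {R : Type u} [CommRing R]

lemma isIso_localCohomology_map (I : Ideal R) (i : ℕ) {S : ShortComplex (ModuleCat.{u} R)}
    (hS : S.ShortExact) (h : ∀ t : ℕ, ∀ j ≤ i,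
      Subsingleton (Abelian.Ext (ModuleCat.of R (R ⧸ I ^ t)) S.X₃ j)) :
    IsIso ((localCohomology I i).map S.f) := by
  let D := localCohomology.diagram (localCohomology.idealPowersDiagram I) i
  let α := Functor.whiskerLeft D ((evaluation _ _).map S.f)
  have hD (t : ℕᵒᵖᵒᵖ) : IsIso (α.app t) :=
    isIso_ext_map hS _ i fun j hj =>
      have : Subsingleton (Abelian.Ext ((localCohomology.ringModIdeals
        (localCohomology.idealPowersDiagram I)).obj (unop t)) S.X₃ j) := h (unop (unop t)) j hj
      isZero_ext_of_subsingleton _ _ j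
  have : IsIso α := NatIso.isIso_of_isIso_app _
  change IsIso ((colimit D).map S.f)
  rw [(Iso.eq_comp_inv _).2 (colimit_map_colimitObjIsoColimitCompEvaluation_hom D S.f)]
  infer_instance

/-- Multiplication by `G` as a map `R ⧸ A ⟶ R ⧸ B`, followed by the projection to
`R ⧸ (B ⊔ (G))`. -/
def mulShortComplex (A B : Ideal R) (G : R) (h : ∀ x ∈ A, G * x ∈ B) :
    ShortComplex (ModuleCat.{u} R) where
  X₁ := ModuleCat.of R (R ⧸ A)
  X₂ := ModuleCat.of R (R ⧸ B)
  X₃ := ModuleCat.of R (R ⧸ (B ⊔ Ideal.span {G}))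
  f := ModuleCat.ofHom (Submodule.mapQ A B (LinearMap.mulLeft R G) h)
  g := ModuleCat.ofHom (Submodule.factor (le_sup_left : B ≤ B ⊔ Ideal.span {G}))
  zero := by
    refine ModuleCat.hom_ext (LinearMap.ext fun x => ?_)
    obtain ⟨x, rfl⟩ := Submodule.Quotient.mk_surjective _ x
    exact (Submodule.Quotient.mk_eq_zero _).2
      (Ideal.mul_mem_right _ _ (Ideal.mem_sup_right (Ideal.mem_span_singleton_self G)))

lemma mulShortComplex_shortExact {A B : Ideal R} {G : R} (h : ∀ x, G * x ∈ B ↔ x ∈ A) :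
    (mulShortComplex A B G fun x => (h x).2).ShortExact := by
  have h₁ : Mono (mulShortComplex A B G fun x => (h x).2).f := by
    refine (ModuleCat.mono_iff_injective _).2 ((injective_iff_map_eq_zero _).2 fun x hx => ?_)
    obtain ⟨x, rfl⟩ := Submodule.Quotient.mk_surjective _ x
    exact (Submodule.Quotient.mk_eq_zero _).2
      ((h x).1 ((Submodule.Quotient.mk_eq_zero _).1 hx))
  have h₂ : Epi (mulShortComplex A B G fun x => (h x).2).g :=
    (ModuleCat.epi_iff_surjective _).2 (Submodule.factor_surjective le_sup_left)
  refine { exact := (ShortComplex.moduleCat_exact_iff _).2 fun x hx => ?_ }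
  obtain ⟨x, rfl⟩ := Submodule.Quotient.mk_surjective _ x
  obtain ⟨b, hb, _, hc, rfl⟩ := Submodule.mem_sup.1 ((Submodule.Quotient.mk_eq_zero _).1 hx)
  obtain ⟨c, rfl⟩ := Ideal.mem_span_singleton'.1 hc
  refine ⟨Submodule.Quotient.mk c, (Submodule.Quotient.eq _).2 ?_⟩
  have : G * c - (b + c * G) = -b := by ring
  change G * c - (b + c * G) ∈ B
  rw [this]
  exact neg_mem hb

lemma subsingleton_ext_quotient {A B : Ideal R} {G : R} (h : ∀ x, G * x ∈ B ↔ x ∈ A)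
    (N : ModuleCat.{u} R) {m : ℕ}
    (hA : ∀ i < m + 1, Subsingleton (Abelian.Ext N (ModuleCat.of R (R ⧸ A)) i))
    (hB : ∀ i < m, Subsingleton (Abelian.Ext N (ModuleCat.of R (R ⧸ B)) i)) :
    ∀ i < m, Subsingleton (Abelian.Ext N (ModuleCat.of R (R ⧸ (B ⊔ Ideal.span {G}))) i) := by
  intro i hi
  have zero₁ := AddCommGrpCat.isZero_of_iff_subsingleton.mpr (hB i hi)
  have zero₂ := AddCommGrpCat.isZero_of_iff_subsingleton.mpr (hA (i + 1) (by omega))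
  exact AddCommGrpCat.subsingleton_of_isZero <| ShortComplex.Exact.isZero_of_both_zeros
    (Abelian.Ext.covariant_sequence_exact₃' N (mulShortComplex_shortExact h) i (i + 1) rfl)
    (zero₁.eq_zero_of_src _) (zero₂.eq_zero_of_tgt _)

end LocalCohomology

section Variables
variable {K : Type u} [Field K] {n : ℕ}

lemma ofList_take_ofFn_X (i : ℕ) :
    Ideal.ofList ((List.ofFn (X : Fin n → MvPolynomial (Fin n) K)).take i) =
      Ideal.span (X '' {j : Fin n | (j : ℕ) < i}) := by
  refine congrArg Ideal.span (Set.ext fun f => ?_)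
  simp only [Set.mem_ofPred_eq, List.mem_take_iff_getElem, Set.mem_image, List.getElem_ofFn,
    List.length_ofFn, lt_min_iff]
  exact ⟨fun ⟨j, hj, h⟩ => ⟨⟨j, hj.2⟩, hj.1, h⟩, fun ⟨j, hj, h⟩ => ⟨j, ⟨hj, j.2⟩, h⟩⟩

lemma ofList_ofFn_X : Ideal.ofList (List.ofFn (X : Fin n → MvPolynomial (Fin n) K)) =
    Ideal.span (Set.range X) :=
  congrArg Ideal.span (Set.ext fun f => by simp)

lemma span_range_X_ne_top :
    Ideal.span (Set.range (X : Fin n → MvPolynomial (Fin n) K)) ≠ ⊤ := by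
  rw [Ne, Ideal.eq_top_iff_one, ← Set.image_univ, mem_ideal_span_X_image]
  simp

lemma mem_span_X_image_of_X_mul_mem {σ : Type*} {s : Set σ} {i : σ} (hi : i ∉ s)
    {f : MvPolynomial σ K} (hf : X i * f ∈ Ideal.span (X '' s)) : f ∈ Ideal.span (X '' s) := by
  rw [mem_ideal_span_X_image] at hf ⊢
  intro m hm
  obtain ⟨j, hj, h⟩ := hf (Finsupp.single i 1 + m) (by
    rwa [mem_support_iff, coeff_X_mul, ← mem_support_iff])
  have hij : i ≠ j := fun h => hi (h ▸ hj)
  exact ⟨j, hj, by simpa [Finsupp.single_apply, hij] using h⟩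

lemma isRegular_ofFn_X : RingTheory.Sequence.IsRegular (MvPolynomial (Fin n) K)
    (List.ofFn (X : Fin n → MvPolynomial (Fin n) K)) where
  regular_mod_prev i hi := by
    rw [ofList_take_ofFn_X, smul_eq_mul, Ideal.mul_top,
      isSMulRegular_quotient_iff_mem_of_smul_mem, List.getElem_ofFn]
    exact fun f => mem_span_X_image_of_X_mul_mem (by simp)
  top_ne_smul := by
    rw [ofList_ofFn_X, smul_eq_mul, Ideal.mul_top]
    exact span_range_X_ne_top.symm

lemma subsingleton_ext_quotient_span_pow (t : ℕ) : ∀ i < n,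
    Subsingleton (Abelian.Ext (ModuleCat.of (MvPolynomial (Fin n) K)
        (_ ⧸ Ideal.span (Set.range (X : Fin n → MvPolynomial (Fin n) K)) ^ t))
      (ModuleCat.of (MvPolynomial (Fin n) K) (_ ⧸ (⊥ : Ideal (MvPolynomial (Fin n) K)))) i) := by
  have reg := ((Submodule.quotEquivOfEqBot (⊥ : Ideal (MvPolynomial (Fin n) K))
    rfl).symm.isRegular_congr _).1 (isRegular_ofFn_X (K := K) (n := n))
  have := ModuleCat.subsingleton_ext_of_exists_isRegular
    (Ideal.span (Set.range (X : Fin n → MvPolynomial (Fin n) K)))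
    (ModuleCat.of (MvPolynomial (Fin n) K)
      (_ ⧸ Ideal.span (Set.range (X : Fin n → MvPolynomial (Fin n) K)) ^ t))
    ?_ (ModuleCat.of (MvPolynomial (Fin n) K) (_ ⧸ (⊥ : Ideal (MvPolynomial (Fin n) K))))
    ?_ _ ?_ reg
  · simpa using this
  · rw [Module.support_eq_zeroLocus, Ideal.annihilator_quotient]
    exact fun p hp => p.2.le_of_pow_le hp
  · rw [← ofList_ofFn_X]
    exact reg.top_ne_smul.symm.lt_top
  · simp only [List.mem_ofFn]
    rintro _ ⟨i, rfl⟩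
    exact Ideal.subset_span ⟨i, rfl⟩

end Variables
end BasicDoubleLink

theorem stmt3 {K : Type} [Field K] [Infinite K] {n : ℕ} (hn : 2 ≤ n)
    (I : Ideal (PR K n)) (hI : IsHomogIdeal I) (hIp : I ≠ ⊤) (hht : 2 ≤ idealHeight I)
    (J : Ideal (PR K n)) (d a : ℕ) (hJ : IsBDL I J d a) :
    ∀ i : ℕ, i ≤ n - 2 →
      Nonempty
        ((localCohomology (Ideal.span (Set.range (X : Fin (n + 1) → PR K n))) i).obj
            (ModuleCat.of (PR K n) (PR K n ⧸ J)) ≅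
          (localCohomology (Ideal.span (Set.range (X : Fin (n + 1) → PR K n))) i).obj
            (ModuleCat.of (PR K n) (PR K n ⧸ I))) := by
  obtain ⟨F, G, hFI, hF, -, -, -, hreg, rfl⟩ := hJ
  intro i hi
  have hG (x : PR K n) : G * x ∈ (⊥ ⊔ Ideal.span {F} : Ideal (PR K n)) ↔
      x ∈ (⊥ ⊔ Ideal.span {F} : Ideal (PR K n)) := by
    rw [bot_sup_eq]
    refine ⟨fun h => ?_, Ideal.mul_mem_left _ _⟩
    rw [← Ideal.Quotient.eq_zero_iff_mem] at h ⊢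
    refine hreg.2 ?_
    simpa [← map_mul] using h
  have hIJ (x : PR K n) : G * x ∈ Ideal.span {G} * I + Ideal.span {F} ↔ x ∈ I := by
    refine ⟨fun h => ?_, fun h => Ideal.mem_sup_left
      (Ideal.mul_mem_mul (Ideal.mem_span_singleton_self G) h)⟩
    obtain ⟨_, hy, z, hz, h⟩ := Submodule.mem_sup.1 h
    obtain ⟨y, hyI, rfl⟩ := Ideal.mem_span_singleton_mul.1 hy
    have hxy : x - y ∈ Ideal.span {F} := by
      rw [← bot_sup_eq (Ideal.span {F}), ← hG, bot_sup_eq, mul_sub, ← h, add_sub_cancel_left]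
      exact hz
    simpa using I.add_mem ((Ideal.span_singleton_le_iff_mem I).2 hFI hxy) hyI
  have hsup : (Ideal.span {G} * I + Ideal.span {F}) ⊔ Ideal.span {G} =
      (⊥ ⊔ Ideal.span {F}) ⊔ Ideal.span {G} := by
    rw [bot_sup_eq]
    exact le_antisymm (sup_le (sup_le (Ideal.mul_le_left.trans le_sup_right) le_sup_left)
      le_sup_right) (sup_le_sup_right le_sup_right _)
  have := BasicDoubleLink.isIso_localCohomology_map
    (Ideal.span (Set.range (X : Fin (n + 1) → PR K n))) i
    (BasicDoubleLink.mulShortComplex_shortExact hIJ) fun t j hj => by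
      have h₀ := BasicDoubleLink.subsingleton_ext_quotient_span_pow (K := K) (n := n + 1) t
      have h₁ := BasicDoubleLink.subsingleton_ext_quotient (A := ⊥) (B := ⊥) (G := F)
        (by simp [hF]) _ h₀ fun k hk => h₀ k (by omega)
      obtain ⟨m, rfl⟩ := Nat.exists_eq_add_of_le' (show 1 ≤ n by omega)
      have h₂ := BasicDoubleLink.subsingleton_ext_quotient hG _ h₁ fun k hk => h₁ k (by omega)
      change Subsingleton (CategoryTheory.Abelian.Ext _ (ModuleCat.of _ (_ ⧸ (_ ⊔ _ : Ideal _))) j)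
      rw [hsup]
      exact h₂ j (by omega)
  exact ⟨(CategoryTheory.asIso ((localCohomology _ i).map (BasicDoubleLink.mulShortComplex I
    (Ideal.span {G} * I + Ideal.span {F}) G fun x => (hIJ x).2).f)).symm⟩
end
end

section
/- Let I ⊆ R be a proper homogeneous ideal of height at least 2 which is saturated, i.e., every x ∈ R such that x·𝔪^k ⊆ I for some k ≥ 0 belongs to I, where 𝔪 = (x_0,…,x_n). Let J = G·I + (F) be a basic double link of I of type (d,a). Then J is also saturated: every x ∈ R with x·𝔪^k ⊆ J for some k ≥ 0 belongs to J. -/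
open MvPolynomial

noncomputable section

/-- If `u, v, G` is a regular sequence (in the elementwise sense of `huv` and `hG`) and so is
`F, G`, then an element multiplied into `(F, G)` by both `u` and `v` lies in `(F, G)`. -/
theorem mem_span_pair_of_mul_mem {A : Type*} [CommRing A] [IsDomain A] {u v F G x : A}
    (hu : u ≠ 0) (hF : F ≠ 0) (huv : ∀ c, u ∣ v * c → u ∣ c)
    (hG : ∀ e, e * G ∈ Ideal.span {u, v} → e ∈ Ideal.span {u, v})
    (hFG : ∀ b, F ∣ G * b → F ∣ b)
    (hxu : x * u ∈ Ideal.span {F, G}) (hxv : x * v ∈ Ideal.span {F, G}) :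
    x ∈ Ideal.span {F, G} := by
  obtain ⟨a, b, hab⟩ := Ideal.mem_span_pair.1 hxu
  obtain ⟨c, d, hcd⟩ := Ideal.mem_span_pair.1 hxv
  obtain ⟨e, he⟩ : F ∣ d * u - b * v := by
    refine hFG _ ⟨a * v - c * u, ?_⟩
    linear_combination u * hcd - v * hab
  have he' : a * v - c * u = e * G := by
    apply mul_left_cancel₀ hF
    linear_combination v * hab - u * hcd + G * he
  obtain ⟨e₂, e₁, hee⟩ := Ideal.mem_span_pair.1
    (hG e (Ideal.mem_span_pair.2 ⟨-c, a, by linear_combination he'⟩))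
  obtain ⟨a', ha'⟩ : u ∣ a - e₁ * G :=
    huv _ ⟨c + e₂ * G, by linear_combination he' - G * hee⟩
  obtain ⟨b', hb'⟩ : u ∣ b + e₁ * F :=
    huv _ ⟨d - e₂ * F, by linear_combination F * hee - he⟩
  refine Ideal.mem_span_pair.2 ⟨a', b', mul_left_cancel₀ hu ?_⟩
  linear_combination hab - F * ha' - G * hb'

/-- An ideal of a polynomial ring containing all `X i - φ (X i)` and killed by the endomorphism
`φ` is the kernel of `φ`. -/
theorem MvPolynomial.ker_algHom_eq {σ K : Type*} [CommRing K]
    (φ : MvPolynomial σ K →ₐ[K] MvPolynomial σ K) {Q : Ideal (MvPolynomial σ K)}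
    (hQ : ∀ i, X i - φ (X i) ∈ Q) (hQ' : Q ≤ RingHom.ker φ) : RingHom.ker φ = Q := by
  refine le_antisymm (fun p hp => ?_) hQ'
  have h : (Ideal.Quotient.mkₐ K Q).comp φ = Ideal.Quotient.mkₐ K Q := by
    ext i
    exact (Ideal.Quotient.eq.2 (hQ i)).symm
  have hp' := DFunLike.congr_fun h p
  rw [AlgHom.comp_apply, (RingHom.mem_ker).1 hp, map_zero] at hp'
  exact Ideal.Quotient.eq_zero_iff_mem.1 hp'.symm

/-- In at least three variables over an infinite field, a nonzero polynomial `G` can be completed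
to a regular sequence `u, v, G` with `u, v` linear forms. -/
theorem exists_linear_regular {K : Type} [Field K] [Infinite K] {n : ℕ} (hn : 2 ≤ n)
    {G : PR K n} (hG : G ≠ 0) :
    ∃ u ∈ Ideal.span (Set.range (X : Fin (n + 1) → PR K n)),
      ∃ v ∈ Ideal.span (Set.range (X : Fin (n + 1) → PR K n)), u ≠ 0 ∧
        (∀ c, u ∣ v * c → u ∣ c) ∧
        ∀ e, e * G ∈ Ideal.span {u, v} → e ∈ Ideal.span {u, v} := by
  obtain ⟨m, rfl⟩ : ∃ m, n = m + 2 := ⟨n - 2, by omega⟩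
  obtain ⟨p, hp⟩ : ∃ p : Fin (m + 2 + 1) → K, eval p (X 0 * G) ≠ 0 := by
    by_contra! h
    exact mul_ne_zero (X_ne_zero 0) hG (MvPolynomial.funext (by simpa using h))
  rw [map_mul, eval_X] at hp
  obtain ⟨hp₀, hpG⟩ := mul_ne_zero_iff.1 hp
  have h10 : (1 : Fin (m + 2 + 1)) ≠ 0 := by simp
  have h20 : (2 : Fin (m + 2 + 1)) ≠ 0 := by
    simp [Fin.ext_iff, Nat.mod_eq_of_lt (show 2 < m + 2 + 1 by omega)]
  have h21 : (2 : Fin (m + 2 + 1)) ≠ 1 := by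
    simp [Fin.ext_iff, Nat.mod_eq_of_lt (show 2 < m + 2 + 1 by omega)]
  have hX := fun i : Fin (m + 2 + 1) =>
    Ideal.subset_span (Set.mem_range_self (f := (X : _ → PR K (m + 2))) i)
  let l (i : Fin (m + 2 + 1)) : PR K (m + 2) := X i - C (p i / p 0) * X 0
  have hl (i) : l i ∈ Ideal.span (Set.range (X : _ → PR K (m + 2))) :=
    sub_mem (hX i) (Ideal.mul_mem_left _ _ (hX 0))
  have hlp (i) : eval p (l i) = 0 := by simp [l, hp₀]
  have hl0 (i) (hi : i ≠ 0) : l i ≠ 0 := by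
    intro h
    have := congrArg (eval (Pi.single i (1 : K))) h
    simp [l, hi.symm] at this
  let φ : PR K (m + 2) →ₐ[K] PR K (m + 2) :=
    aeval (Function.update X 1 (C (p 1 / p 0) * X 0))
  have hφ₁ : φ (X 1) = C (p 1 / p 0) * X 0 := by simp [φ]
  have hφ (i) (hi : i ≠ 1) : φ (X i) = X i := by simp [φ, hi]
  have hφC (c) : φ (C c) = C c := φ.commutes c
  have hkerφ : RingHom.ker φ = Ideal.span {l 1} := by
    refine MvPolynomial.ker_algHom_eq φ (fun i => ?_) ?_
    · by_cases hi : i = 1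
      · subst hi
        rw [hφ₁]
        exact Ideal.subset_span rfl
      · simp [hφ i hi]
    · rw [Ideal.span_le, Set.singleton_subset_iff]
      simp [l, RingHom.mem_ker, hφ₁, hφ 0 h10.symm, hφC]
  let ψ : PR K (m + 2) →ₐ[K] PR K (m + 2) :=
    aeval (Function.update (Function.update X 1 (C (p 1 / p 0) * X 0)) 2 (C (p 2 / p 0) * X 0))
  have hψ₁ : ψ (X 1) = C (p 1 / p 0) * X 0 := by simp [ψ, h21.symm]
  have hψ₂ : ψ (X 2) = C (p 2 / p 0) * X 0 := by simp [ψ]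
  have hψ (i) (hi : i ≠ 1) (hi' : i ≠ 2) : ψ (X i) = X i := by simp [ψ, hi, hi']
  have hψC (c) : ψ (C c) = C c := ψ.commutes c
  have hkerψ : RingHom.ker ψ = Ideal.span {l 1, l 2} := by
    refine MvPolynomial.ker_algHom_eq ψ (fun i => ?_) ?_
    · by_cases hi : i = 1
      · subst hi
        rw [hψ₁]
        exact Ideal.subset_span (by simp [l])
      by_cases hi' : i = 2
      · subst hi'
        rw [hψ₂]
        exact Ideal.subset_span (by simp [l])
      · simp [hψ i hi hi']
    · rw [Ideal.span_le, Set.insert_subset_iff, Set.singleton_subset_iff]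
      simp [l, RingHom.mem_ker, hψ₁, hψ₂, hψ 0 h10.symm h20.symm, hψC]
  refine ⟨l 1, hl 1, l 2, hl 2, hl0 1 h10, fun c hc => ?_, fun e he => ?_⟩
  · rw [← Ideal.mem_span_singleton, ← hkerφ, RingHom.mem_ker] at hc ⊢
    rw [map_mul] at hc
    refine (mul_eq_zero.1 hc).resolve_left ?_
    have : φ (l 2) = l 2 := by simp [l, hφ 2 h21, hφ 0 h10.symm, hφC]
    rw [this]
    exact hl0 2 h20
  · have hGψ : ψ G ≠ 0 := by
      intro h
      rw [← RingHom.mem_ker, hkerψ] at h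
      obtain ⟨r, s, rfl⟩ := Ideal.mem_span_pair.1 h
      simp [hlp] at hpG
    rw [← hkerψ, RingHom.mem_ker] at he ⊢
    rw [map_mul] at he
    exact (mul_eq_zero.1 he).resolve_right hGψ

/-- An ideal `I` with `I : 𝔪 = I` is saturated. -/
theorem isSatIdeal_of_colon {K : Type} [Field K] {n : ℕ} {I : Ideal (PR K n)}
    (h : ∀ x : PR K n,
      (∀ y ∈ Ideal.span (Set.range (X : Fin (n + 1) → PR K n)), x * y ∈ I) → x ∈ I) :
    IsSatIdeal I := by
  rintro x ⟨k, hk⟩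
  induction k with
  | zero => simpa using hk 1 (by simp)
  | succ k ih =>
    refine ih fun y hy => h _ fun z hz => ?_
    rw [mul_assoc]
    refine hk _ ?_
    rw [pow_succ]
    exact Ideal.mul_mem_mul hy hz

theorem IsRegSeq.dvd_of_dvd_mul {K : Type} [Field K] {n : ℕ} {F G : PR K n}
    (h : IsRegSeq F G) (b : PR K n) (hb : F ∣ G * b) : F ∣ b := by
  rw [← Ideal.mem_span_singleton, ← Ideal.Quotient.eq_zero_iff_mem] at hb ⊢
  apply h.2
  simpa using hb

/-- A complete intersection of codimension two in at least three variables is saturated. -/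
theorem IsRegSeq.isSatIdeal_span_pair {K : Type} [Field K] [Infinite K] {n : ℕ} (hn : 2 ≤ n)
    {F G : PR K n} (hF : F ≠ 0) (hG : G ≠ 0) (h : IsRegSeq F G) :
    IsSatIdeal (Ideal.span {F, G}) := by
  obtain ⟨u, hu, v, hv, hu0, huv, huvG⟩ := exists_linear_regular hn hG
  exact isSatIdeal_of_colon fun x hx =>
    mem_span_pair_of_mul_mem hu0 hF huv huvG h.dvd_of_dvd_mul (hx u hu) (hx v hv)

theorem stmt4 {K : Type} [Field K] [Infinite K] {n : ℕ} (hn : 2 ≤ n)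
    (I : Ideal (PR K n)) (hI : IsHomogIdeal I) (hIp : I ≠ ⊤) (hht : 2 ≤ idealHeight I)
    (hsat : IsSatIdeal I)
    (J : Ideal (PR K n)) (d a : ℕ) (hJ : IsBDL I J d a) :
    IsSatIdeal J := by
  obtain ⟨F, G, hFI, hF0, -, -, -, hreg, rfl⟩ := hJ
  have hG0 : G ≠ 0 := by
    rintro rfl
    have h1 : F ∣ 1 := hreg.dvd_of_dvd_mul 1 (by simp)
    exact hIp ((Ideal.eq_top_iff_one I).2 (I.mem_of_dvd h1 hFI))
  have hle : Ideal.span {G} * I + Ideal.span {F} ≤ Ideal.span {F, G} := by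
    rw [Ideal.span_insert, Submodule.add_eq_sup, sup_comm]
    exact sup_le_sup le_rfl Ideal.mul_le_left
  rintro x ⟨k, hk⟩
  obtain ⟨a', b, rfl⟩ := Ideal.mem_span_pair.1
    (hreg.isSatIdeal_span_pair hn hF0 hG0 x ⟨k, fun y hy => hle (hk y hy)⟩)
  have hb : b ∈ I := by
    refine hsat b ⟨k, fun y hy => ?_⟩
    obtain ⟨s, hs, t, ht, hst⟩ := Submodule.mem_sup.1 (hk y hy)
    obtain ⟨i, hi, rfl⟩ := Ideal.mem_span_singleton_mul.1 hs
    obtain ⟨c, rfl⟩ := Ideal.mem_span_singleton.1 ht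
    have hdvd : F ∣ b * y - i :=
      hreg.dvd_of_dvd_mul _ ⟨c - a' * y, by linear_combination -hst⟩
    have := I.add_mem (I.mem_of_dvd hdvd hFI) hi
    rwa [sub_add_cancel] at this
  refine Submodule.mem_sup.2 ⟨G * b, Ideal.mul_mem_mul (Ideal.mem_span_singleton_self G) hb,
    a' * F, Ideal.mul_mem_left _ _ (Ideal.mem_span_singleton_self F), ?_⟩
  ring
end
end

section
/- Let I ⊆ R be an ideal, let F ∈ I, and let G ∈ R. Then the radical of the ideal G·I + (F) equals the radical of the ideal I ∩ (F, G). (Geometrically, this expresses that the scheme defined by a basic double link is, as a set, the union of the scheme defined by I and the complete intersection defined by F and G.) -/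
open MvPolynomial

noncomputable section

/-- If `F ∈ I`, then `G · I + (F)` and `I ∩ (F, G)` have the same radical. -/
theorem radical_span_singleton_mul_add_span_singleton {A : Type*} [CommRing A] (I : Ideal A)
    {F : A} (G : A) (hF : F ∈ I) :
    (Ideal.span {G} * I + Ideal.span {F}).radical = (I ⊓ Ideal.span {F, G}).radical := by
  apply le_antisymm
  · refine Ideal.radical_mono (sup_le (le_inf Ideal.mul_le_right ?_) (le_inf ?_ ?_))
    · exact Ideal.mul_le_left.trans (Ideal.span_mono (by simp))
    · rwa [Ideal.span_singleton_le_iff_mem]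
    · exact Ideal.span_mono (by simp)
  · refine Ideal.radical_le_radical_iff.mpr ?_
    rintro x ⟨hxI, hx⟩
    obtain ⟨a, b, rfl⟩ := Ideal.mem_span_pair.mp hx
    set x := a * F + b * G with hxdef
    refine ⟨2, ?_⟩
    have hsq : x ^ 2 = G * (b * x) + a * x * F := by rw [hxdef]; ring
    rw [hsq]
    exact Ideal.add_mem _
      (Ideal.mem_sup_left (Ideal.mul_mem_mul (Ideal.mem_span_singleton_self G)
        (I.mul_mem_left b hxI)))
      (Ideal.mem_sup_right (Ideal.mul_mem_left _ _ (Ideal.mem_span_singleton_self F)))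

theorem stmt5 {K : Type} [Field K] [Infinite K] {n : ℕ} (hn : 2 ≤ n)
    (I : Ideal (PR K n)) (F G : PR K n) (hFI : F ∈ I) :
    (Ideal.span {G} * I + Ideal.span {F}).radical = (I ⊓ Ideal.span {F, G}).radical :=
  radical_span_singleton_mul_add_span_singleton I G hFI
end
end

section
/- Let s_1 ≥ s_2 ≥ … ≥ s_{ν−1} > 0 and r_1 ≥ r_2 ≥ … ≥ r_ν > 0 be integers with Σ_{j=1}^{ν} r_j = Σ_{i=1}^{ν−1} s_i and s_{ν−1} > r_ν ≥ 1. Then the following two conditions are equivalent: (i) for every integer k ≥ r_ν one has #{ i : r_i ≤ k } > #{ j : s_j ≤ k }; (ii) s_i ≥ r_i for all i = 1,…,ν−1. -/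
open MvPolynomial

noncomputable section

/-- If `r` is bounded by `s` at each index but its last, where it is at most `k`, then `r` has
more values at most `k` than `s` has. -/
theorem card_filter_le_lt_of_castSucc_le {α : Type*} [LinearOrder α] {n : ℕ} {s : Fin n → α}
    {r : Fin (n + 1) → α} (h : ∀ i, r i.castSucc ≤ s i) {k : α} (hk : r (Fin.last n) ≤ k) :
    (Finset.univ.filter fun j => s j ≤ k).card < (Finset.univ.filter fun i => r i ≤ k).card := by
  rw [← Finset.card_map Fin.castSuccEmb]
  refine Finset.card_lt_card (Finset.ssubset_iff.2 ⟨Fin.last n, ?_, ?_⟩)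
  · simp [Fin.castSucc_ne_last]
  · intro x hx
    simp only [Finset.mem_insert, Finset.mem_map, Finset.mem_filter, Finset.mem_univ,
      true_and] at hx ⊢
    obtain rfl | ⟨j, hj, rfl⟩ := hx
    exacts [hk, (h j).trans hj]

/-- For nonincreasing `s` and `r` with `s i < r i`, at most as many values of `r` as of `s` are
bounded by `s i`. -/
theorem card_filter_le_le_of_lt_castSucc {α : Type*} [LinearOrder α] {n : ℕ} {s : Fin n → α}
    {r : Fin (n + 1) → α} (hs : Antitone s) (hr : Antitone r) {i : Fin n}
    (hi : s i < r i.castSucc) :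
    (Finset.univ.filter fun j => r j ≤ s i).card ≤
      (Finset.univ.filter fun j => s j ≤ s i).card := by
  calc
    (Finset.univ.filter fun j => r j ≤ s i).card ≤ (Finset.Ioi i.castSucc).card := by
      refine Finset.card_le_card fun j hj => Finset.mem_Ioi.2 (lt_of_not_ge fun hji => ?_)
      exact (hi.trans_le (hr hji)).not_ge (Finset.mem_filter.1 hj).2
    _ = (Finset.Ici i).card := by simp
    _ ≤ (Finset.univ.filter fun j => s j ≤ s i).card :=
      Finset.card_le_card fun j hj =>
        Finset.mem_filter.2 ⟨Finset.mem_univ j, hs (Finset.mem_Ici.1 hj)⟩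

theorem stmt7 (m : ℕ) (s : Fin (m + 1) → ℤ) (r : Fin (m + 2) → ℤ)
    (hs : Antitone s) (hr : Antitone r)
    (hspos : ∀ i, 0 < s i) (hrpos : ∀ j, 0 < r j)
    (hsum : ∑ j, r j = ∑ i, s i)
    (hlast : r (Fin.last (m + 1)) < s (Fin.last m))
    (hrlast : 1 ≤ r (Fin.last (m + 1))) :
    (∀ k : ℤ, r (Fin.last (m + 1)) ≤ k →
        (Finset.univ.filter fun j => s j ≤ k).card <
          (Finset.univ.filter fun i => r i ≤ k).card) ↔
      ∀ i : Fin (m + 1), r i.castSucc ≤ s i := by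
  refine ⟨fun h i => ?_, fun h k hk => card_filter_le_lt_of_castSucc_le h hk⟩
  by_contra! hi
  exact (h (s i) (hlast.le.trans (hs (Fin.le_last i)))).not_ge
    (card_filter_le_le_of_lt_castSucc hs hr hi)
end
end

section
/- Let s_1 ≥ s_2 ≥ … ≥ s_{ν−1} > 0 and r_1 ≥ r_2 ≥ … ≥ r_ν > 0 be integers with Σ_{j=1}^{ν} r_j = Σ_{i=1}^{ν−1} s_i, s_{ν−1} > r_ν ≥ 1, and s_i ≥ r_i for all i = 1,…,ν−1. Then there exists a proper homogeneous ideal J ⊆ R of height 2 such that R/J is Cohen–Macaulay and the Hilbert function of R/J satisfies h_{R/J}(k) = h_R(k) − Σ_{j=1}^{ν} h_R(k − r_j) + Σ_{i=1}^{ν−1} h_R(k − s_i) for every integer k. (Such a J is given by the maximal minors of the (ν−1)×ν bidiagonal matrix whose (i,i) entry is x_0^{s_i − r_i} and whose (i,i+1) entry is x_1^{s_i − r_{i+1}}, corresponding to a free resolution 0 → ⊕_i R(−s_i) → ⊕_j R(−r_j) → J → 0.) -/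
open MvPolynomial

noncomputable section

theorem HasLen1FreeRes.basicDoubleLink {A : Type} [CommRing A] [IsDomain A] {J : Ideal A}
    (hJ : HasLen1FreeRes J) {F G : A} (hF : F ∈ J) (hG : G ≠ 0)
    (hFG : ∀ w, G ∣ F * w → G ∣ w) :
    HasLen1FreeRes (Ideal.span {G} * J ⊔ Ideal.span {F}) := by
  obtain ⟨p, q, f, g, hf, hfg, hg⟩ := hJ
  obtain ⟨v, rfl⟩ : F ∈ LinearMap.range g := hg ▸ hF
  let ep := Fin.consLinearEquiv A (fun _ : Fin (p + 1) => A)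
  let eq := Fin.consLinearEquiv A (fun _ : Fin (q + 1) => A)
  let f' : A × (Fin p → A) →ₗ[A] A × (Fin q → A) :=
    LinearMap.prod (G • LinearMap.fst _ _ _)
      (f ∘ₗ LinearMap.snd _ _ _ - (LinearMap.toSpanSingleton A _ v) ∘ₗ LinearMap.fst _ _ _)
  let g' : A × (Fin q → A) →ₗ[A] A :=
    (LinearMap.toSpanSingleton A _ (g v)) ∘ₗ LinearMap.fst _ _ _
      + G • (g ∘ₗ LinearMap.snd _ _ _)
  have hf' : ∀ x, f' x = (G * x.1, f x.2 - x.1 • v) := fun x => rfl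
  have hg' : ∀ x, g' x = x.1 * g v + G * g x.2 := fun x => rfl
  have hgf : ∀ y, g (f y) = 0 := fun y => by
    have : f y ∈ LinearMap.ker g := hfg ▸ LinearMap.mem_range_self f y
    simpa using this
  refine ⟨p + 1, q + 1, eq.toLinearMap ∘ₗ f' ∘ₗ ep.symm.toLinearMap,
    g' ∘ₗ eq.symm.toLinearMap, ?_, ?_, ?_⟩
  · have : Function.Injective f' := by
      rw [injective_iff_map_eq_zero]
      rintro ⟨z, y⟩ h
      simp only [hf', Prod.mk_eq_zero, mul_eq_zero, hG, false_or] at h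
      obtain ⟨rfl, h⟩ := h
      rw [zero_smul, sub_zero] at h
      simp [(injective_iff_map_eq_zero f).1 hf y h]
    simpa using this
  · have key : LinearMap.ker g' = LinearMap.range f' := by
      ext ⟨w, u⟩
      simp only [LinearMap.mem_ker, LinearMap.mem_range, Prod.exists, hf', hg', Prod.mk.injEq]
      constructor
      · intro h
        obtain ⟨z, rfl⟩ : G ∣ w := hFG w ⟨-g u, by linear_combination h⟩
        have hu : g (u + z • v) = 0 := by
          refine mul_left_cancel₀ hG ?_
          simp only [map_add, map_smul, smul_eq_mul]
          linear_combination h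
        obtain ⟨y, hy⟩ : u + z • v ∈ LinearMap.range f := hfg ▸ hu
        exact ⟨z, y, rfl, by rw [hy]; abel⟩
      · rintro ⟨z, y, rfl, rfl⟩
        simp only [map_sub, map_smul, smul_eq_mul, hgf]
        ring
    ext x
    rw [LinearMap.mem_ker, LinearMap.comp_apply, ← LinearMap.mem_ker, key]
    simp only [LinearMap.mem_range, LinearMap.comp_apply, LinearEquiv.coe_coe]
    constructor
    · rintro ⟨y, hy⟩
      exact ⟨ep y, by simp [hy]⟩
    · rintro ⟨y, hy⟩
      exact ⟨ep.symm y, by simp [← hy]⟩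
  · ext x
    simp only [LinearMap.mem_range, LinearMap.comp_apply, LinearEquiv.coe_coe, Submodule.mem_sup,
      Ideal.mem_span_singleton_mul, Ideal.mem_span_singleton', ← hg]
    constructor
    · rintro ⟨y, rfl⟩
      exact ⟨_, ⟨_, ⟨(eq.symm y).2, rfl⟩, rfl⟩, _, ⟨(eq.symm y).1, rfl⟩, by rw [hg', add_comm]⟩
    · rintro ⟨_, ⟨_, ⟨u, rfl⟩, rfl⟩, _, ⟨w, rfl⟩, rfl⟩
      exact ⟨eq (w, u), by simp [hg', add_comm]⟩

theorem hasLen1FreeRes_top {A : Type} [CommRing A] : HasLen1FreeRes (⊤ : Ideal A) := by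
  refine ⟨0, 1, 0, LinearMap.proj 0, Function.injective_of_subsingleton _, ?_, ?_⟩
  · ext x
    simp [funext_iff, Fin.forall_fin_one, eq_comm]
  · exact LinearMap.range_eq_top.2 (LinearMap.proj_surjective 0)

/-- The monomial ideal generated by the `x_i ^ a k * x_j ^ b k` for `k ≤ M`. -/
def staircaseIdeal (R : Type) [CommRing R] {σ : Type} (i j : σ) (a b : ℕ → ℕ) (M : ℕ) :
    Ideal (MvPolynomial σ R) :=
  Ideal.span ((fun k => X i ^ a k * X j ^ b k) '' Set.Iic M)

theorem mem_staircaseIdeal {R : Type} [CommRing R] {σ : Type} {i j : σ} (hij : i ≠ j)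
    {a b : ℕ → ℕ} {M : ℕ} {f : MvPolynomial σ R} :
    f ∈ staircaseIdeal R i j a b M ↔ ∀ e ∈ f.support, ∃ k ≤ M, a k ≤ e i ∧ b k ≤ e j := by
  classical
  have h : (fun k => X i ^ a k * X j ^ b k : ℕ → MvPolynomial σ R) '' Set.Iic M =
      (fun e => monomial e (1 : R)) ''
        ((fun k => Finsupp.single i (a k) + Finsupp.single j (b k)) '' Set.Iic M) := by
    rw [Set.image_image]
    simp [X_pow_eq_monomial, monomial_mul]
  rw [staircaseIdeal, h, mem_ideal_span_monomial_image]
  refine forall₂_congr fun e _ => ?_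
  simp only [Set.exists_mem_image, Set.mem_Iic]
  refine exists_congr fun k => and_congr_right fun _ => ⟨fun h => ⟨?_, ?_⟩, fun h l => ?_⟩
  · simpa [hij] using h i
  · simpa [hij.symm] using h j
  · by_cases hi : l = i
    · subst hi; simpa [hij] using h.1
    · by_cases hj : l = j
      · subst hj; simpa [hij.symm] using h.2
      · simp [Ne.symm hi, Ne.symm hj]

theorem staircaseIdeal_succ {R : Type} [CommRing R] {σ : Type} {i j : σ}
    {a b : ℕ → ℕ} {M : ℕ} (hb : Antitone b) (hM : b (M + 1) = 0) :
    staircaseIdeal R i j a b (M + 1) =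
      Ideal.span {X j ^ b M} * staircaseIdeal R i j a (fun k => b k - b M) M ⊔
        Ideal.span {X i ^ a (M + 1)} := by
  have hset : Set.Iic (M + 1) = insert (M + 1) (Set.Iic M) := by
    ext k; simp only [Set.mem_Iic, Set.mem_insert_iff]; omega
  rw [staircaseIdeal, hset, Set.image_insert_eq, Ideal.span_insert, sup_comm, hM, pow_zero,
    mul_one, staircaseIdeal, Ideal.span_mul_span', Set.singleton_mul, Set.image_image]
  congr 2
  refine Set.image_congr fun k hk => ?_
  have : b k = b M + (b k - b M) := by have := hb (Set.mem_Iic.1 hk); omega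
  conv_lhs => rw [this, pow_add]
  ring

theorem hasLen1FreeRes_staircaseIdeal {K : Type} [Field K] {σ : Type} {i j : σ} (hij : i ≠ j)
    {a : ℕ → ℕ} (ha : Monotone a) (h0 : a 0 = 0) (M : ℕ) :
    ∀ {b : ℕ → ℕ}, Antitone b → b M = 0 → HasLen1FreeRes (staircaseIdeal K i j a b M) := by
  induction M with
  | zero =>
    intro b _ hM
    have : staircaseIdeal K i j a b 0 = ⊤ := by
      rw [Ideal.eq_top_iff_one, mem_staircaseIdeal hij]
      exact fun e _ => ⟨0, le_rfl, by simp [h0], by simp [hM]⟩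
    exact this ▸ hasLen1FreeRes_top
  | succ M ih =>
    intro b hb hM
    rw [staircaseIdeal_succ hb hM]
    refine (ih (fun k l h => Nat.sub_le_sub_right (hb h) _) (by simp)).basicDoubleLink
      ?_ (pow_ne_zero _ (X_ne_zero j)) fun w hw => ?_
    · refine Ideal.mem_of_dvd _ (pow_dvd_pow _ (ha M.le_succ))
        (Ideal.subset_span ⟨M, Set.mem_Iic.2 le_rfl, by simp⟩)
    · refine IsRelPrime.dvd_of_dvd_mul_left (IsRelPrime.pow ?_) hw
      rw [(X_prime (R := K) (i := j)).irreducible.isRelPrime_iff_not_dvd, X_dvd_X]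
      exact fun h => hij h.symm

theorem isHomogIdeal_staircaseIdeal {K : Type} [Field K] {n : ℕ} {i j : Fin (n + 1)} (hij : i ≠ j)
    (a b : ℕ → ℕ) (M : ℕ) : IsHomogIdeal (staircaseIdeal K i j a b M) := by
  intro F hF d
  rw [mem_staircaseIdeal hij] at hF ⊢
  intro e he
  refine hF e ?_
  rw [mem_support_iff, coeff_homogeneousComponent] at he
  rw [mem_support_iff]
  exact fun h => he (by simp [h])

theorem two_le_height_of_X_mem {K : Type} [Field K] {σ : Type} {i j : σ} (hij : i ≠ j)
    (P : PrimeSpectrum (MvPolynomial σ K)) (hi : X i ∈ P.asIdeal) (hj : X j ∈ P.asIdeal) :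
    2 ≤ Order.height P := by
  have hp : (Ideal.span {(X i : MvPolynomial σ K)}).IsPrime :=
    (Ideal.span_singleton_prime (X_ne_zero i)).2 X_prime
  let Q : PrimeSpectrum (MvPolynomial σ K) := ⟨_, hp⟩
  have h1 : Q < P := by
    refine lt_of_le_of_ne ((Ideal.span_singleton_le_iff_mem _).2 hi) fun h => hij ?_
    rw [← h] at hj
    exact (X_dvd_X (R := K)).1 (Ideal.mem_span_singleton.1 hj)
  have h2 : (⊥ : PrimeSpectrum (MvPolynomial σ K)) < Q := by
    refine lt_of_le_of_ne bot_le fun h => X_ne_zero (R := K) i ?_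
    have : X i ∈ Q.asIdeal := Ideal.mem_span_singleton_self _
    rw [← h] at this
    simp at this
  calc (2 : ℕ∞) = 0 + 1 + 1 := by norm_num
    _ ≤ Order.height Q + 1 := by
      gcongr; exact (add_le_add_left zero_le 1).trans (Order.height_add_one_le h2)
    _ ≤ Order.height P := Order.height_add_one_le h1

theorem staircaseIdeal_le_span_pair {R : Type} [CommRing R] {σ : Type} {i j : σ}
    {a b : ℕ → ℕ} {M : ℕ} (h : ∀ k ≤ M, 0 < a k + b k) :
    staircaseIdeal R i j a b M ≤ Ideal.span {X i, X j} := by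
  rw [staircaseIdeal, Ideal.span_le]
  rintro _ ⟨k, hk, rfl⟩
  rcases Nat.eq_zero_or_pos (a k) with h0 | h0
  · have : b k ≠ 0 := by have := h k hk; omega
    exact Ideal.mul_mem_left _ _ (Ideal.pow_mem_of_mem _ (Ideal.subset_span (by simp)) _
      (Nat.pos_of_ne_zero this))
  · exact Ideal.mul_mem_right _ _ (Ideal.pow_mem_of_mem _ (Ideal.subset_span (by simp)) _ h0)

theorem span_X_pair_ne_top {K : Type} [Field K] {σ : Type} (i j : σ) :
    (Ideal.span {X i, X j} : Ideal (MvPolynomial σ K)) ≠ ⊤ := by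
  have : (Ideal.span {X i, X j} : Ideal (MvPolynomial σ K)) ≤
      RingHom.ker (constantCoeff (σ := σ) (R := K)) := by
    rw [Ideal.span_le]
    rintro _ (rfl | rfl) <;> simp
  exact fun h => (RingHom.ker_ne_top _) (top_le_iff.1 (h ▸ this))

theorem idealHeight_staircaseIdeal {K : Type} [Field K] {n : ℕ} {i j : Fin (n + 1)} (hij : i ≠ j)
    {a b : ℕ → ℕ} {M : ℕ} (h : ∀ k ≤ M, 0 < a k + b k) (h0 : a 0 = 0) (hM : b M = 0) :
    idealHeight (staircaseIdeal K i j a b M) = 2 := by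
  apply le_antisymm
  · obtain ⟨P, hP⟩ := Ideal.nonempty_minimalPrimes (span_X_pair_ne_top (K := K) i j)
    have hprime := hP.isPrime
    refine (iInf₂_le (⟨P, hprime⟩ : PrimeSpectrum _)
      ((staircaseIdeal_le_span_pair h).trans hP.1.2)).trans ?_
    rw [← PrimeSpectrum.height_eq_orderHeight]
    refine (Ideal.height_le_card_of_mem_minimalPrimes_span (by simp) hP).trans ?_
    exact_mod_cast (Set.ncard_insert_le _ _).trans (by simp)
  · refine le_iInf₂ fun P hP => two_le_height_of_X_mem hij P ?_ ?_
    · refine P.2.mem_of_pow_mem (a M) (hP (Ideal.subset_span ⟨M, Set.mem_Iic.2 le_rfl, ?_⟩))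
      simp [hM]
    · refine P.2.mem_of_pow_mem (b 0) (hP (Ideal.subset_span ⟨0, Nat.zero_le _, ?_⟩))
      simp [h0]

open Finset in
theorem card_filter_exists_le_staircase {σ : Type} (T : Finset (σ →₀ ℕ)) (i j : σ)
    {a b : ℕ → ℕ} (ha : Monotone a) (hb : Antitone b) (M : ℕ) :
    (#{e ∈ T | ∃ k ≤ M, a k ≤ e i ∧ b k ≤ e j} : ℤ) =
      ∑ k ∈ range (M + 1), (#{e ∈ T | a k ≤ e i ∧ b k ≤ e j} : ℤ) -
        ∑ k ∈ range M, (#{e ∈ T | a (k + 1) ≤ e i ∧ b k ≤ e j} : ℤ) := by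
  classical
  induction M with
  | zero => simp
  | succ M ih =>
    have hunion : ({e ∈ T | ∃ k ≤ M + 1, a k ≤ e i ∧ b k ≤ e j} : Finset (σ →₀ ℕ)) =
        {e ∈ T | ∃ k ≤ M, a k ≤ e i ∧ b k ≤ e j} ∪
          {e ∈ T | a (M + 1) ≤ e i ∧ b (M + 1) ≤ e j} := by
      rw [← filter_or]
      refine filter_congr fun e _ => ?_
      constructor
      · rintro ⟨k, hk, h⟩
        rcases Nat.le_succ_iff.1 hk with hk | rfl
        exacts [Or.inl ⟨k, hk, h⟩, Or.inr h]
      · rintro (⟨k, hk, h⟩ | h)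
        exacts [⟨k, hk.trans M.le_succ, h⟩, ⟨M + 1, le_rfl, h⟩]
    have hinter : ({e ∈ T | ∃ k ≤ M, a k ≤ e i ∧ b k ≤ e j} : Finset (σ →₀ ℕ)) ∩
          {e ∈ T | a (M + 1) ≤ e i ∧ b (M + 1) ≤ e j} =
        {e ∈ T | a (M + 1) ≤ e i ∧ b M ≤ e j} := by
      rw [← filter_and]
      refine filter_congr fun e _ => ?_
      constructor
      · rintro ⟨⟨k, hk, h⟩, h'⟩
        exact ⟨h'.1, (hb hk).trans h.2⟩
      · rintro ⟨h, h'⟩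
        exact ⟨⟨M, le_rfl, (ha M.le_succ).trans h, h'⟩, h, (hb M.le_succ).trans h'⟩
    have := card_union_add_card_inter {e ∈ T | ∃ k ≤ M, a k ≤ e i ∧ b k ≤ e j}
      {e ∈ T | a (M + 1) ≤ e i ∧ b (M + 1) ≤ e j}
    rw [← hunion, hinter] at this
    rw [sum_range_succ,
      sum_range_succ (fun k => (#{e ∈ T | a (k + 1) ≤ e i ∧ b k ≤ e j} : ℤ))]
    have := congrArg (Nat.cast : ℕ → ℤ) this
    push_cast at this
    linarith

open Finset in
theorem card_finsuppAntidiag_eq_hPoly (n t : ℕ) :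
    (#((univ : Finset (Fin (n + 1))).finsuppAntidiag t) : ℤ) = hPoly n t := by
  rw [card_finsuppAntidiag_nat_eq_choose, hPoly, if_neg (by omega), card_univ, Fintype.card_fin,
    Int.toNat_natCast, show n + 1 + t - 1 = n + t by omega, Nat.choose_symm_add]

open Finset in
theorem card_filter_finsuppAntidiag_eq_hPoly {n : ℕ} {i j : Fin (n + 1)} (hij : i ≠ j)
    (t a b : ℕ) :
    (#{e ∈ (univ : Finset (Fin (n + 1))).finsuppAntidiag t | a ≤ e i ∧ b ≤ e j} : ℤ) =
      hPoly n (t - (a + b : ℕ)) := by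
  let d : Fin (n + 1) →₀ ℕ := Finsupp.single i a + Finsupp.single j b
  have hd : ∀ e : Fin (n + 1) →₀ ℕ, d ≤ e ↔ a ≤ e i ∧ b ≤ e j := by
    intro e
    refine ⟨fun h => ⟨?_, ?_⟩, fun h l => ?_⟩
    · simpa [d, hij] using h i
    · simpa [d, hij.symm] using h j
    · by_cases hi : l = i
      · subst hi; simpa [d, hij] using h.1
      · by_cases hj : l = j
        · subst hj; simpa [d, hij.symm] using h.2
        · simp [d, Ne.symm hi, Ne.symm hj]
  have hsum : ∑ l, d l = a + b := by
    simp [d, sum_add_distrib, Finsupp.single_apply]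
  simp_rw [← hd]
  by_cases ht : a + b ≤ t
  · have : ({e ∈ (univ : Finset (Fin (n + 1))).finsuppAntidiag t | d ≤ e} : Finset _) =
        ((univ : Finset (Fin (n + 1))).finsuppAntidiag (t - (a + b))).map
          (addRightEmbedding d) := by
      ext e
      simp only [mem_filter, mem_finsuppAntidiag, subset_univ, and_true, mem_map,
        addRightEmbedding_apply]
      constructor
      · rintro ⟨h, hle⟩
        refine ⟨e - d, ?_, tsub_add_cancel_of_le hle⟩
        have : ∑ l, (e - d) l + ∑ l, d l = t := by
          rw [← sum_add_distrib, ← h]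
          exact sum_congr rfl fun l _ => Nat.sub_add_cancel (hle l)
        change ∑ l, (e - d) l = _
        omega
      · rintro ⟨u, hu, rfl⟩
        refine ⟨?_, le_add_self⟩
        change ∑ l, u l = _ at hu
        change ∑ l, (u l + d l) = t
        rw [sum_add_distrib, hsum]
        omega
    rw [this, card_map, card_finsuppAntidiag_eq_hPoly, Nat.cast_sub ht]
  · rw [hPoly, if_pos (by omega), filter_eq_empty_iff.2, card_empty, Nat.cast_zero]
    intro e he hle
    have h1 : ∑ l, e l = t := (mem_finsuppAntidiag.1 he).1
    have h2 : ∑ l, d l ≤ ∑ l, e l := sum_le_sum fun l _ => hle l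
    omega

theorem finrank_restrictSupport_finset {K : Type} [Field K] {σ : Type} (T : Finset (σ →₀ ℕ)) :
    Module.finrank K (restrictSupport K (T : Set (σ →₀ ℕ))) = T.card := by
  rw [Module.finrank_eq_nat_card_basis (basisRestrictSupport K (T : Set (σ →₀ ℕ)))]
  simp

theorem mem_homogeneousSubmodule_iff_support {K : Type} [Field K] {n t : ℕ} {f : PR K n} :
    f ∈ homogeneousSubmodule (Fin (n + 1)) K t ↔
      ∀ e ∈ f.support, e ∈ (Finset.univ : Finset (Fin (n + 1))).finsuppAntidiag t := by
  rw [homogeneousSubmodule_eq_finsupp_supported]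
  change (f.support : Set (Fin (n + 1) →₀ ℕ)) ⊆ _ ↔ _
  simp only [Set.subset_def, Finset.mem_coe, Set.mem_ofPred_eq, Finset.mem_finsuppAntidiag,
    Finset.subset_univ, and_true, Finsupp.degree_eq_sum]

theorem finrank_homogeneousSubmodule_eq_hPoly (K : Type) [Field K] (n t : ℕ) :
    (Module.finrank K (homogeneousSubmodule (Fin (n + 1)) K t) : ℤ) = hPoly n t := by
  have : homogeneousSubmodule (Fin (n + 1)) K t =
      restrictSupport K ((Finset.univ : Finset (Fin (n + 1))).finsuppAntidiag t) := by
    ext f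
    rw [mem_homogeneousSubmodule_iff_support, mem_restrictSupport_iff]
    rfl
  rw [this, finrank_restrictSupport_finset, card_finsuppAntidiag_eq_hPoly]

theorem hilbQuot_staircaseIdeal {K : Type} [Field K] {n : ℕ} {i j : Fin (n + 1)} (hij : i ≠ j)
    {a b : ℕ → ℕ} (ha : Monotone a) (hb : Antitone b) (M : ℕ) (t : ℤ) :
    hilbQuot (staircaseIdeal K i j a b M) t =
      hPoly n t - ∑ k ∈ Finset.range (M + 1), hPoly n (t - (a k + b k : ℕ)) +
        ∑ k ∈ Finset.range M, hPoly n (t - (a (k + 1) + b k : ℕ)) := by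
  rcases lt_or_ge t 0 with ht | ht
  · have h0 : ∀ c : ℕ, hPoly n (t - c) = 0 := fun c => if_pos (by omega)
    simp only [h0, Finset.sum_const_zero]
    simp [hilbQuot, hPoly, ht]
  · lift t to ℕ using ht
    have : ((staircaseIdeal K i j a b M).restrictScalars K ⊓
        homogeneousSubmodule (Fin (n + 1)) K t : Submodule K (PR K n)) =
        restrictSupport K ((Finset.univ : Finset (Fin (n + 1))).finsuppAntidiag t |>.filter
          fun e => ∃ k ≤ M, a k ≤ e i ∧ b k ≤ e j : Finset (Fin (n + 1) →₀ ℕ)) := by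
      ext f
      rw [Submodule.mem_inf, Submodule.restrictScalars_mem, mem_homogeneousSubmodule_iff_support,
        mem_staircaseIdeal hij, mem_restrictSupport_iff, Finset.coe_subset, ← forall₂_and]
      refine forall₂_congr fun e _ => ?_
      rw [Finset.mem_filter, and_comm]
    rw [hilbQuot, if_neg (by omega), Int.toNat_natCast, this, finrank_restrictSupport_finset,
      finrank_homogeneousSubmodule_eq_hPoly, card_filter_exists_le_staircase _ _ _ ha hb]
    simp_rw [card_filter_finsuppAntidiag_eq_hPoly hij]
    ring

theorem stmt8 {K : Type} [Field K] [Infinite K] {n : ℕ} (hn : 2 ≤ n)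
    (m : ℕ) (s : Fin (m + 1) → ℤ) (r : Fin (m + 2) → ℤ)
    (hs : Antitone s) (hr : Antitone r)
    (hspos : ∀ i, 0 < s i) (hrpos : ∀ j, 0 < r j)
    (hsum : ∑ j, r j = ∑ i, s i)
    (hlast : r (Fin.last (m + 1)) < s (Fin.last m))
    (hrlast : 1 ≤ r (Fin.last (m + 1)))
    (hdiag : ∀ i : Fin (m + 1), r i.castSucc ≤ s i) :
    ∃ J : Ideal (PR K n), J ≠ ⊤ ∧ IsHomogIdeal J ∧ idealHeight J = 2 ∧ HasLen1FreeRes J ∧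
      ∀ k : ℤ, hilbQuot J k
        = hPoly n k - ∑ j, hPoly n (k - r j) + ∑ i, hPoly n (k - s i) := by
  obtain ⟨S, hS⟩ : ∃ S : ℕ → ℤ, ∀ i : Fin (m + 1), S i = s i :=
    ⟨fun i => if h : i < m + 1 then s ⟨i, h⟩ else 0, fun i => dif_pos i.2⟩
  obtain ⟨T, hT⟩ : ∃ T : ℕ → ℤ, ∀ i : Fin (m + 2), T i = r i :=
    ⟨fun i => if h : i < m + 2 then r ⟨i, h⟩ else 0, fun i => dif_pos i.2⟩
  have hTS : ∀ k < m + 1, T k ≤ S k := fun k hk => by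
    have := hdiag ⟨k, hk⟩
    rwa [← hS, ← hT] at this
  have hTT : ∀ k < m + 1, T (k + 1) ≤ T k := fun k hk => by
    have := hr (Fin.castSucc_le_succ ⟨k, hk⟩)
    rwa [← hT, ← hT] at this
  have hTpos : ∀ k < m + 2, 0 < T k := fun k hk => by
    have := hrpos ⟨k, hk⟩
    rwa [← hT] at this
  have hsum' : ∑ k ∈ Finset.range (m + 2), T k = ∑ k ∈ Finset.range (m + 1), S k := by
    rw [Finset.sum_range, Finset.sum_range]
    simpa only [hS, hT] using hsum
  let a : ℕ → ℕ := fun k => ∑ l ∈ Finset.range k, (S l - T l).toNat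
  let b : ℕ → ℕ := fun k => ∑ l ∈ Finset.Ico k (m + 1), (S l - T (l + 1)).toNat
  have ha : Monotone a := fun k l h =>
    Finset.sum_le_sum_of_subset (Finset.range_subset_range.2 h)
  have hb : Antitone b := fun k l h =>
    Finset.sum_le_sum_of_subset (Finset.Ico_subset_Ico_left h)
  have ha0 : a 0 = 0 := rfl
  have hbm : b (m + 1) = 0 := by simp [b]
  have ha_succ : ∀ k < m + 1, (a (k + 1) : ℤ) = a k + (S k - T k) := fun k hk => by
    have := hTS k hk
    simp only [a, Finset.sum_range_succ, Nat.cast_add]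
    omega
  have hb_succ : ∀ k < m + 1, (b k : ℤ) = (S k - T (k + 1)) + b (k + 1) := fun k hk => by
    have := hTS k hk
    have := hTT k hk
    simp only [b, Finset.sum_eq_sum_Ico_succ_bot hk, Nat.cast_add]
    omega
  have hab : ∀ k ≤ m + 1, ((a k + b k : ℕ) : ℤ) = T k := by
    intro k
    induction k with
    | zero =>
      intro _
      have : (b 0 : ℤ) = ∑ k ∈ Finset.range (m + 1), (S k - T (k + 1)) := by
        simp only [b, Nat.cast_sum, Finset.range_eq_Ico]
        refine Finset.sum_congr rfl fun k hk => Int.toNat_of_nonneg ?_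
        have hk := (Finset.mem_Ico.1 hk).2
        have := hTS k hk
        have := hTT k hk
        omega
      rw [Nat.cast_add, ha0, this, Finset.sum_sub_distrib, ← hsum', Finset.sum_range_succ' T]
      simp
    | succ k ih =>
      intro hk
      have := ih (by omega)
      have := ha_succ k (by omega)
      have := hb_succ k (by omega)
      push_cast at *
      linarith
  have hij : (0 : Fin (n + 1)) ≠ Fin.last n := by
    simp [Fin.ext_iff]; omega
  have hpos : ∀ k ≤ m + 1, 0 < a k + b k := fun k hk => by
    have := hab k hk
    have := hTpos k (by omega)
    omega
  refine ⟨staircaseIdeal K 0 (Fin.last n) a b (m + 1), fun h => ?_,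
    isHomogIdeal_staircaseIdeal hij a b _, idealHeight_staircaseIdeal hij hpos ha0 hbm,
    hasLen1FreeRes_staircaseIdeal hij ha ha0 _ hb hbm, fun t => ?_⟩
  · exact span_X_pair_ne_top _ _ (top_le_iff.1 (h ▸ staircaseIdeal_le_span_pair hpos))
  · rw [hilbQuot_staircaseIdeal hij ha hb, Finset.sum_range, Finset.sum_range]
    congr 1
    · congr 1
      refine Finset.sum_congr rfl fun k _ => ?_
      rw [hab k (by omega), hT]
    · refine Finset.sum_congr rfl fun k _ => ?_
      have h1 := hab k (by omega)
      have h2 := ha_succ k k.2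
      rw [← hS, show ((a (k + 1) + b k : ℕ) : ℤ) = S k by push_cast at *; linarith]
end
end

section
/- Let I ⊆ R be a proper homogeneous ideal of height at least 2. Suppose there are integers s_1 ≥ … ≥ s_{ν−1} and r_1 ≥ … ≥ r_ν with Σ_{j=1}^{ν} r_j = Σ_{i=1}^{ν−1} s_i and s_{ν−1} > r_ν ≥ 1, such that the Hilbert function of R/I satisfies h_{R/I}(k) = h_R(k) − Σ_{j=1}^{ν} h_R(k − r_j) + Σ_{i=1}^{ν−1} h_R(k − s_i) for every integer k (such sequences arise as the twists at the even and odd steps of a graded free resolution of R/I). Then I is numerically ACM if and only if s_i ≥ r_i for all i = 1,…,ν−1. -/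
open MvPolynomial

noncomputable section

/-- The dimension of the space of forms of degree `t` in `n + 1` variables. -/
theorem finrank_homogeneousSubmodule_fin (K : Type) [Field K] (n t : ℕ) :
    Module.finrank K (homogeneousSubmodule (Fin (n + 1)) K t) = Nat.choose (n + t) n := by
  rw [homogeneousSubmodule_eq_finsupp_supported]
  have hset : {d : Fin (n + 1) →₀ ℕ | d.degree = t}
      = ((Finset.univ.finsuppAntidiag t : Finset (Fin (n + 1) →₀ ℕ)) : Set _) := by
    ext d
    simp [Finset.mem_finsuppAntidiag, Finsupp.degree_eq_sum]
  rw [hset, (AddMonoidAlgebra.supportedEquivFinsupp (R := K) (S := K) _).finrank_eq]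
  rw [Module.finrank_finsupp_self, ← Nat.card_eq_fintype_card, Nat.card_coe_set_eq,
    Set.ncard_coe_finset, Finset.card_finsuppAntidiag_nat_eq_choose]
  simp only [Finset.card_univ, Fintype.card_fin]
  rw [show n + 1 + t - 1 = n + t by omega, Nat.choose_symm_add]

section Grading

variable {K : Type} [Field K] {n : ℕ}

instance homogeneousSubmodule_finite (t : ℕ) :
    Module.Finite K (homogeneousSubmodule (Fin (n + 1)) K t) :=
  Module.Finite.iff_fg.mpr (homogeneousSubmodule_fg _ _ t)

theorem homogeneousComponent_mul_of_isHomogeneous {b : PR K n} {e : ℕ} (hb : b.IsHomogeneous e)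
    (a : PR K n) (t : ℕ) :
    homogeneousComponent t (a * b)
      = if e ≤ t then homogeneousComponent (t - e) a * b else 0 := by
  let _ := MvPolynomial.gradedAlgebra (σ := Fin (n + 1)) (R := K)
  have h := DirectSum.coe_decompose_mul_of_right_mem (homogeneousSubmodule (Fin (n + 1)) K)
    (a := a) t ((mem_homogeneousSubmodule e b).mpr hb)
  have hd : ∀ (φ : PR K n) (i : ℕ), (DirectSum.decompose (homogeneousSubmodule (Fin (n + 1)) K) φ i :
      PR K n) = homogeneousComponent i φ := decomposition.decompose'_apply
  simpa only [hd] using h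

/-- A family of `K`-linear endomorphisms `c t` of an `R`-module which behaves like the projections
onto the components of a grading by `ℕ`. -/
structure IsGradingComp {M : Type} [AddCommGroup M] [Module K M] [Module (PR K n) M]
    (c : ℕ → M →ₗ[K] M) : Prop where
  idem : ∀ t m, c t (c t m) = c t m
  sum : ∀ m, ∃ T, m = ∑ t ∈ Finset.range T, c t m
  smul : ∀ (a : PR K n) (m : M) (e t : ℕ), c e m = m →
    c t (a • m) = if e ≤ t then homogeneousComponent (t - e) a • m else 0

theorem isGradingComp_homogeneousComponent :
    IsGradingComp (n := n) (M := PR K n) (fun t => homogeneousComponent (R := K) t) where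
  idem t m := homogeneousComponent_eq_self (homogeneousComponent_isHomogeneous t m)
  sum m := ⟨m.totalDegree + 1, (sum_homogeneousComponent m).symm⟩
  smul a m e t h := by
    have hm : m.IsHomogeneous e := h ▸ homogeneousComponent_isHomogeneous e m
    exact homogeneousComponent_mul_of_isHomogeneous hm a t

/-- The component of degree `t` of the graded free module `⨁ R(-d j)`. -/
def wcomp {q : ℕ} (d : Fin q → ℕ) (t : ℕ) : (Fin q → PR K n) →ₗ[K] (Fin q → PR K n) :=
  LinearMap.pi fun j =>
    if d j ≤ t then homogeneousComponent (t - d j) ∘ₗ LinearMap.proj j else 0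

theorem wcomp_apply {q : ℕ} (d : Fin q → ℕ) (t : ℕ) (v : Fin q → PR K n) (j : Fin q) :
    wcomp d t v j = if d j ≤ t then homogeneousComponent (t - d j) (v j) else 0 := by
  unfold wcomp
  rw [LinearMap.pi_apply]
  split_ifs <;> rfl

theorem isGradingComp_wcomp {q : ℕ} (d : Fin q → ℕ) :
    IsGradingComp (n := n) (M := Fin q → PR K n) (wcomp d) where
  idem t m := by
    ext1 j
    simp only [wcomp_apply]
    split_ifs
    · exact homogeneousComponent_eq_self (homogeneousComponent_isHomogeneous _ _)
    · rfl
  sum m := by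
    refine ⟨Finset.univ.sup (fun j => d j + (m j).totalDegree) + 1, ?_⟩
    ext1 j
    have hj : d j + (m j).totalDegree ≤ Finset.univ.sup (fun j => d j + (m j).totalDegree) :=
      Finset.le_sup (f := fun j => d j + (m j).totalDegree) (Finset.mem_univ j)
    set S := Finset.univ.sup (fun j => d j + (m j).totalDegree)
    rw [Finset.sum_apply]
    simp only [wcomp_apply]
    rw [show S + 1 = d j + (S + 1 - d j) by omega, Finset.sum_range_add]
    rw [Finset.sum_eq_zero (fun t ht => if_neg (by simpa using ht)), zero_add]
    simp only [le_add_iff_nonneg_right, zero_le, if_true, add_tsub_cancel_left]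
    conv_lhs => rw [← sum_homogeneousComponent (m j)]
    refine Finset.sum_subset (by intro x; simp; omega) fun t _ ht => ?_
    exact homogeneousComponent_eq_zero _ _ (by simp at ht; omega)
  smul a m e t h := by
    ext1 j
    have hj := congrFun h j
    rw [wcomp_apply] at hj ⊢
    rw [Pi.smul_apply, smul_eq_mul]
    by_cases hde : d j ≤ e
    · rw [if_pos hde] at hj
      have hm : (m j).IsHomogeneous (e - d j) := hj ▸ homogeneousComponent_isHomogeneous _ _
      rw [homogeneousComponent_mul_of_isHomogeneous hm]
      by_cases het : e ≤ t
      · rw [if_pos (hde.trans het), if_pos (by omega), if_pos het,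
          show t - d j - (e - d j) = t - e by omega]
        rfl
      · rw [if_neg het]
        split_ifs
        · omega
        · rfl
        · rfl
    · rw [if_neg hde] at hj
      rw [← hj]
      split_ifs <;> simp [← hj]

theorem wcomp_eq_self_iff {q : ℕ} {d : Fin q → ℕ} {t : ℕ} {v : Fin q → PR K n} :
    wcomp d t v = v ↔ ∀ j, if d j ≤ t then (v j).IsHomogeneous (t - d j) else v j = 0 := by
  rw [funext_iff]
  refine forall_congr' fun j => ?_
  rw [wcomp_apply]
  split_ifs
  · exact ⟨fun h => h ▸ homogeneousComponent_isHomogeneous _ _, homogeneousComponent_eq_self⟩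
  · exact eq_comm

namespace IsGradingComp

variable {M : Type} [AddCommGroup M] [Module K M] [Module (PR K n) M] {c : ℕ → M →ₗ[K] M}

theorem apply_sum_smul (hc : IsGradingComp (n := n) c) {p : ℕ} {v : Fin p → M} {e : Fin p → ℕ}
    (hv : ∀ i, c (e i) (v i) = v i) (t : ℕ) (a : Fin p → PR K n) :
    c t (∑ i, a i • v i) = ∑ i, wcomp e t a i • v i := by
  rw [map_sum]
  refine Finset.sum_congr rfl fun i _ => ?_
  rw [hc.smul _ _ _ _ (hv i), wcomp_apply]
  split_ifs
  · rfl
  · rw [zero_smul]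

theorem exists_homogeneous_generators (hc : IsGradingComp (n := n) c)
    {N : Submodule (PR K n) M} (hfg : N.FG) (hN : ∀ x ∈ N, ∀ t, c t x ∈ N) :
    ∃ (p : ℕ) (v : Fin p → M) (e : Fin p → ℕ), (∀ i, c (e i) (v i) = v i) ∧
      Submodule.span (PR K n) (Set.range v) = N := by
  classical
  obtain ⟨S, hS⟩ := hfg
  choose T hT using hc.sum
  let I := Σ x : S, Fin (T x)
  let E := Fintype.equivFin I
  refine ⟨Fintype.card I, fun i => c (E.symm i).2 (E.symm i).1, fun i => (E.symm i).2,
    fun i => hc.idem _ _, le_antisymm ?_ ?_⟩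
  · rw [Submodule.span_le]
    rintro _ ⟨i, rfl⟩
    exact hN _ (hS ▸ Submodule.subset_span (E.symm i).1.2) _
  · rw [← hS, Submodule.span_le]
    intro x hx
    rw [SetLike.mem_coe, hT x]
    refine Submodule.sum_mem _ fun t ht => Submodule.subset_span ?_
    refine ⟨E ⟨⟨x, hx⟩, ⟨t, Finset.mem_range.mp ht⟩⟩, ?_⟩
    dsimp only
    rw [Equiv.symm_apply_apply]

theorem exists_minimal_generators (hc : IsGradingComp (n := n) c)
    {N : Submodule (PR K n) M} (hfg : N.FG) (hN : ∀ x ∈ N, ∀ t, c t x ∈ N) :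
    ∃ (p : ℕ) (v : Fin p → M) (e : Fin p → ℕ), (∀ i, c (e i) (v i) = v i) ∧
      Submodule.span (PR K n) (Set.range v) = N ∧
      ∀ a : Fin p → PR K n, ∑ i, a i • v i = 0 → ∀ i, constantCoeff (a i) = 0 := by
  classical
  have hex := hc.exists_homogeneous_generators hfg hN
  obtain ⟨v, e, hv, hspan⟩ := Nat.find_spec hex
  have hmin := fun k => Nat.find_min (m := k) hex
  generalize Nat.find hex = p at *
  refine ⟨p, v, e, hv, hspan, fun a ha i => ?_⟩
  by_contra hi
  obtain _ | p := p
  · exact i.elim0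
  refine hmin p (Nat.lt_succ_self p)
    ⟨v ∘ i.succAbove, e ∘ i.succAbove, fun j => hv _, ?_⟩
  rw [← hspan]
  refine le_antisymm (Submodule.span_mono (Set.range_comp_subset_range _ _)) ?_
  rw [Submodule.span_le]
  rintro _ ⟨j, rfl⟩
  obtain rfl | ⟨j, rfl⟩ := Fin.eq_self_or_eq_succAbove i j
  swap
  · exact Submodule.subset_span ⟨j, rfl⟩
  have h0 := hc.apply_sum_smul hv (e j) a
  rw [ha, map_zero, Fin.sum_univ_succAbove _ j, wcomp_apply, if_pos le_rfl, Nat.sub_self,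
    homogeneousComponent_zero] at h0
  have h1 := eq_neg_of_add_eq_zero_left h0.symm
  have h2 : v j = (C (constantCoeff (a j))⁻¹ : PR K n) • ((C (coeff 0 (a j)) : PR K n) • v j) := by
    rw [smul_smul, ← C_mul, ← constantCoeff_eq, inv_mul_cancel₀ hi, C_1, one_smul]
  rw [SetLike.mem_coe, h2, h1]
  refine Submodule.smul_mem _ _ (Submodule.neg_mem _ (Submodule.sum_mem _ fun k _ => ?_))
  exact Submodule.smul_mem _ _ (Submodule.subset_span ⟨k, rfl⟩)

end IsGradingComp

/-- A surjection from a free module onto a projective module whose relations have no constant terms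
is injective. -/
theorem linearIndependent_of_projective_span {M : Type} [AddCommGroup M] [Module (PR K n) M]
    {p : ℕ} {v : Fin p → M}
    [Module.Projective (PR K n) (Submodule.span (PR K n) (Set.range v))]
    (hv : ∀ a : Fin p → PR K n, ∑ i, a i • v i = 0 → ∀ i, constantCoeff (a i) = 0) :
    LinearIndependent (PR K n) v := by
  classical
  set w : Fin p → Submodule.span (PR K n) (Set.range v) :=
    fun i => ⟨v i, Submodule.subset_span ⟨i, rfl⟩⟩ with hw
  set Φ := Fintype.linearCombination (PR K n) w
  have hΦ : ∀ a, (Φ a : M) = ∑ i, a i • v i := fun a => by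
    simp [Φ, Fintype.linearCombination_apply, hw]
  have hsurj : Function.Surjective Φ := by
    rintro ⟨x, hx⟩
    obtain ⟨a, ha⟩ := (Submodule.mem_span_range_iff_exists_fun _).mp hx
    exact ⟨a, Subtype.ext ((hΦ a).trans ha)⟩
  obtain ⟨σ, hσ⟩ := Module.projective_lifting_property Φ LinearMap.id hsurj
  set P : (Fin p → PR K n) →ₗ[PR K n] (Fin p → PR K n) := LinearMap.id - σ ∘ₗ Φ with hP
  set m : Ideal (PR K n) := RingHom.ker (constantCoeff (R := K) (σ := Fin (n + 1))) with hm
  have hPm : ∀ a i, P a i ∈ m := by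
    intro a i
    refine hv (P a) ?_ i
    have : Φ (P a) = 0 := by
      have h := LinearMap.congr_fun hσ (Φ a)
      simp only [LinearMap.comp_apply, LinearMap.id_apply] at h
      simp [hP, h]
    rw [← hΦ, this]
    rfl
  rw [Fintype.linearIndependent_iff]
  intro a ha
  have hPa : P a = a := by
    have : Φ a = 0 := Subtype.ext ((hΦ a).trans ha)
    simp [hP, this]
  have hpow : ∀ k i, a i ∈ m ^ k := by
    intro k
    induction k with
    | zero => simp
    | succ k ih =>
      intro i
      have h : a i = ∑ j, a j * P (Pi.single j 1) i := by
        conv_lhs => rw [← hPa, LinearMap.pi_apply_eq_sum_univ P a]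
        rw [Finset.sum_apply]
        refine Finset.sum_congr rfl fun j _ => ?_
        rw [Pi.smul_apply, smul_eq_mul]
        refine congrArg (fun w => a j * P w i) ?_
        ext1 k
        simp only [Pi.single_apply, eq_comm]
      rw [h, pow_succ]
      exact Submodule.sum_mem _ fun j _ => Ideal.mul_mem_mul (ih j) (hPm _ i)
  have hne : m ≠ ⊤ := by
    rw [Ideal.ne_top_iff_one, hm, RingHom.mem_ker, map_one]
    exact one_ne_zero
  intro i
  have hi : a i ∈ ⨅ k, m ^ k := by
    simp only [Submodule.mem_iInf]
    exact fun k => hpow k i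
  rw [Ideal.iInf_pow_eq_bot_of_isDomain m hne] at hi
  simpa using hi


/-- Generators `g` of `J` of degrees `d`, together with a homogeneous basis `v` of their syzygy
module, of degrees `e`. -/
structure IsGradedRes (J : Ideal (PR K n)) {p q : ℕ} (d : Fin q → ℕ) (e : Fin p → ℕ)
    (g : Fin q → PR K n) (v : Fin p → Fin q → PR K n) : Prop where
  homog_gen : ∀ j, (g j).IsHomogeneous (d j)
  homog_syz : ∀ i, wcomp d (e i) (v i) = v i
  span_gen : Ideal.span (Set.range g) = J
  linearIndependent : LinearIndependent (PR K n) v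
  span_syz : Submodule.span (PR K n) (Set.range v)
    = LinearMap.ker (Fintype.linearCombination (PR K n) g)

theorem projective_ker_of_free_res {A : Type} [CommRing A] {p q q' : ℕ}
    {f : (Fin p → A) →ₗ[A] (Fin q → A)} {g : (Fin q → A) →ₗ[A] A}
    (hf : Function.Injective f) (hfg : LinearMap.ker g = LinearMap.range f)
    {g' : (Fin q' → A) →ₗ[A] A} (hg : LinearMap.range g = LinearMap.range g') :
    Module.Projective A (LinearMap.ker g') := by
  obtain ⟨α, hα⟩ := Module.projective_lifting_property g'.rangeRestrict
    (g.codRestrict (LinearMap.range g') fun x => hg ▸ ⟨x, rfl⟩) g'.surjective_rangeRestrict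
  obtain ⟨β, hβ⟩ := Module.projective_lifting_property g.rangeRestrict
    (g'.codRestrict (LinearMap.range g) fun x => hg ▸ ⟨x, rfl⟩) g.surjective_rangeRestrict
  have hα' : ∀ x, g' (α x) = g x := fun x => congrArg Subtype.val (LinearMap.congr_fun hα x)
  have hβ' : ∀ x, g (β x) = g' x := fun x => congrArg Subtype.val (LinearMap.congr_fun hβ x)
  have hgf : ∀ u, g (f u) = 0 := fun u => by
    rw [← LinearMap.mem_ker, hfg]
    exact ⟨u, rfl⟩
  let E := LinearEquiv.ofInjective f hf
  let β₀ : LinearMap.ker g' →ₗ[A] LinearMap.range f :=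
    (β ∘ₗ (LinearMap.ker g').subtype).codRestrict _ fun x => by
      rw [← hfg, LinearMap.mem_ker, LinearMap.comp_apply, hβ']
      exact x.2
  let ρ : (Fin p → A) × (Fin q' → A) →ₗ[A] (Fin q' → A) :=
    (α ∘ₗ f).coprod (LinearMap.id - α ∘ₗ β)
  refine Module.Projective.of_split
    ((E.symm.toLinearMap ∘ₗ β₀).prod (LinearMap.ker g').subtype)
    (ρ.codRestrict _ fun x => ?_) ?_
  · simp [ρ, hα', hβ', hgf]
  · ext1 x
    have h : f (E.symm (β₀ x)) = β x :=
      congrArg Subtype.val (E.apply_symm_apply (β₀ x))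
    refine Subtype.ext ?_
    change α (f (E.symm (β₀ x))) + (x.1 - α (β x.1)) = x.1
    rw [h, add_sub_cancel]

theorem linearCombination_wcomp {p : ℕ} {g : Fin p → PR K n} {d : Fin p → ℕ}
    (hg : ∀ i, (g i).IsHomogeneous (d i)) (t : ℕ) (a : Fin p → PR K n) :
    Fintype.linearCombination (PR K n) g (wcomp d t a)
      = homogeneousComponent t (Fintype.linearCombination (PR K n) g a) := by
  rw [Fintype.linearCombination_apply, Fintype.linearCombination_apply]
  exact (isGradingComp_homogeneousComponent.apply_sum_smul
    (fun i => homogeneousComponent_eq_self (hg i)) t a).symm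

theorem exists_isGradedRes {J : Ideal (PR K n)} (hJ : IsHomogIdeal J) (hres : HasLen1FreeRes J) :
    ∃ (p q : ℕ) (d : Fin q → ℕ) (e : Fin p → ℕ) (g : Fin q → PR K n)
      (v : Fin p → Fin q → PR K n), IsGradedRes J d e g v := by
  obtain ⟨_, _, f, g₀, hf, hfg, hg₀⟩ := hres
  obtain ⟨q, g, d, hg, hspan⟩ :=
    isGradingComp_homogeneousComponent.exists_homogeneous_generators
      (IsNoetherian.noetherian J) hJ
  have hhom : ∀ j, (g j).IsHomogeneous (d j) :=
    fun j => hg j ▸ homogeneousComponent_isHomogeneous _ _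
  obtain ⟨p, v, e, hv, hvspan, hmin⟩ :=
    (isGradingComp_wcomp d).exists_minimal_generators
      (N := LinearMap.ker (Fintype.linearCombination (PR K n) g))
      (IsNoetherian.noetherian _) fun x hx t => by
        rw [LinearMap.mem_ker] at hx ⊢
        rw [linearCombination_wcomp hhom, hx, map_zero]
  have : Module.Projective (PR K n) (Submodule.span (PR K n) (Set.range v)) := by
    rw [hvspan]
    refine projective_ker_of_free_res hf hfg ?_
    rw [hg₀, Fintype.range_linearCombination, hspan]
  exact ⟨p, q, d, e, g, v, hhom, hv, hspan, linearIndependent_of_projective_span hmin, hvspan⟩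

theorem IsGradedRes.hasLen1FreeRes {J : Ideal (PR K n)} {p q : ℕ} {d : Fin q → ℕ} {e : Fin p → ℕ}
    {g : Fin q → PR K n} {v : Fin p → Fin q → PR K n} (h : IsGradedRes J d e g v) :
    HasLen1FreeRes J := by
  refine ⟨p, q, Fintype.linearCombination (PR K n) v, Fintype.linearCombination (PR K n) g,
    linearIndependent_iff_injective_fintypeLinearCombination.mp h.linearIndependent, ?_, ?_⟩
  · rw [Fintype.range_linearCombination, h.span_syz]
  · rw [Fintype.range_linearCombination]
    exact h.span_gen

theorem IsGradedRes.isHomogIdeal {J : Ideal (PR K n)} {p q : ℕ} {d : Fin q → ℕ} {e : Fin p → ℕ}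
    {g : Fin q → PR K n} {v : Fin p → Fin q → PR K n} (h : IsGradedRes J d e g v) :
    IsHomogIdeal J := by
  intro F hF t
  rw [← h.span_gen, ← Ideal.submodule_span_eq, ← Fintype.range_linearCombination] at hF ⊢
  obtain ⟨a, rfl⟩ := hF
  exact ⟨wcomp d t a, linearCombination_wcomp h.homog_gen t a⟩

/-- The degree `t` part of the graded free module `⨁ R(-d j)`. -/
def wpart {q : ℕ} (d : Fin q → ℕ) (t : ℕ) : Submodule K (Fin q → PR K n) :=
  Submodule.pi Set.univ fun j => if d j ≤ t then homogeneousSubmodule (Fin (n + 1)) K (t - d j) else ⊥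

theorem mem_wpart {q : ℕ} {d : Fin q → ℕ} {t : ℕ} {v : Fin q → PR K n} :
    v ∈ wpart d t ↔ wcomp d t v = v := by
  rw [wcomp_eq_self_iff]
  simp only [wpart, Submodule.mem_pi, Set.mem_univ, true_implies]
  refine forall_congr' fun j => ?_
  split_ifs <;> simp

/-- `⨁ R(-d j)` in degree `t`, as a product. -/
def wpartEquiv {q : ℕ} (d : Fin q → ℕ) (t : ℕ) :
    wpart (K := K) (n := n) d t ≃ₗ[K]
      ∀ j, (if d j ≤ t then homogeneousSubmodule (Fin (n + 1)) K (t - d j) else ⊥ :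
        Submodule K (PR K n)) where
  toFun v j := ⟨v.1 j, v.2 j (Set.mem_univ j)⟩
  invFun w := ⟨fun j => w j, fun j _ => (w j).2⟩
  map_add' _ _ := rfl
  map_smul' _ _ := rfl
  left_inv _ := rfl
  right_inv _ := rfl

instance (b : Prop) [Decidable b] (t : ℕ) :
    Module.Finite K (if b then homogeneousSubmodule (Fin (n + 1)) K t else ⊥ :
        Submodule K (PR K n)) :=
  Submodule.finiteDimensional_of_le (S₂ := homogeneousSubmodule (Fin (n + 1)) K t) (by
    split_ifs
    · exact le_rfl
    · exact bot_le)

instance {q : ℕ} (d : Fin q → ℕ) (t : ℕ) : Module.Finite K (wpart (K := K) (n := n) d t) :=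
  Module.Finite.equiv (wpartEquiv d t).symm

theorem finrank_wpart {q : ℕ} (d : Fin q → ℕ) (t : ℕ) :
    (Module.finrank K (wpart (K := K) (n := n) d t) : ℤ) = ∑ j, hPoly n ((t : ℤ) - d j) := by
  rw [(wpartEquiv d t).finrank_eq, Module.finrank_pi_fintype, Nat.cast_sum]
  refine Finset.sum_congr rfl fun j _ => ?_
  unfold hPoly
  by_cases h : d j ≤ t
  · rw [if_pos h, if_neg (by omega), finrank_homogeneousSubmodule_fin]
    congr 3
    omega
  · rw [if_neg h, if_pos (by omega), finrank_bot, Nat.cast_zero]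

theorem IsGradedRes.hilbQuot_eq {J : Ideal (PR K n)} {p q : ℕ} {d : Fin q → ℕ} {e : Fin p → ℕ}
    {g : Fin q → PR K n} {v : Fin p → Fin q → PR K n} (h : IsGradedRes J d e g v) (k : ℤ) :
    hilbQuot J k = hPoly n k - ∑ j, hPoly n (k - d j) + ∑ i, hPoly n (k - e i) := by
  by_cases hk : k < 0
  · have hz : ∀ a : ℕ, hPoly n (k - a) = 0 := fun a => if_pos (by omega)
    have h0 : hPoly n k = 0 := if_pos hk
    simp [hilbQuot, hk, hz, h0]
  obtain ⟨t, rfl⟩ := Int.eq_ofNat_of_zero_le (not_lt.mp hk)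
  rw [hilbQuot, if_neg hk, Int.toNat_natCast, finrank_homogeneousSubmodule_fin]
  rw [← finrank_wpart (K := K) d t, ← finrank_wpart (K := K) e t]
  have hP : hPoly n t = Nat.choose (n + t) n := by
    rw [hPoly, if_neg hk, Int.toNat_natCast]
  rw [hP]
  set G := (Fintype.linearCombination (PR K n) g).restrictScalars K
  set V := (Fintype.linearCombination (PR K n) v).restrictScalars K
  have hV : Function.Injective V := linearIndependent_iff_injective_fintypeLinearCombination.mp h.linearIndependent
  have hVw : ∀ a, V (wcomp e t a) = wcomp d t (V a) := fun a =>
    ((isGradingComp_wcomp d).apply_sum_smul h.homog_syz t a).symm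
  have hGw : ∀ a, G (wcomp d t a) = homogeneousComponent t (G a) :=
    linearCombination_wcomp h.homog_gen t
  have hker : ∀ x, G x = 0 ↔ ∃ a, V a = x := fun x => by
    have := h.span_syz
    rw [← Fintype.range_linearCombination] at this
    exact (SetLike.ext_iff.mp this x).symm
  have hrange : ∀ x, x ∈ J ↔ ∃ a, G a = x := fun x => by
    rw [← h.span_gen, ← Ideal.submodule_span_eq, ← Fintype.range_linearCombination]
    rfl
  have hmap : (wpart d t).map G
      = Submodule.restrictScalars K J ⊓ homogeneousSubmodule (Fin (n + 1)) K t := by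
    ext x
    rw [Submodule.mem_map, Submodule.mem_inf, Submodule.restrictScalars_mem, hrange,
      mem_homogeneousSubmodule]
    constructor
    · rintro ⟨a, ha, rfl⟩
      rw [mem_wpart] at ha
      exact ⟨⟨a, rfl⟩, ha ▸ hGw a ▸ homogeneousComponent_isHomogeneous _ _⟩
    · rintro ⟨⟨a, rfl⟩, ha⟩
      refine ⟨wcomp d t a, mem_wpart.mpr ((isGradingComp_wcomp d).idem _ _), ?_⟩
      rw [hGw, homogeneousComponent_eq_self ha]
  have hmapV : (wpart e t).map V = LinearMap.ker G ⊓ wpart d t := by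
    ext x
    rw [Submodule.mem_map, Submodule.mem_inf, LinearMap.mem_ker, hker]
    constructor
    · rintro ⟨a, ha, rfl⟩
      rw [mem_wpart] at ha ⊢
      exact ⟨⟨a, rfl⟩, by rw [← hVw, ha]⟩
    · rintro ⟨⟨a, rfl⟩, ha⟩
      rw [mem_wpart] at ha
      exact ⟨wcomp e t a, mem_wpart.mpr ((isGradingComp_wcomp e).idem _ _), by rw [hVw, ha]⟩
  have h1 : Module.finrank K (wpart (K := K) (n := n) e t)
      = Module.finrank K (LinearMap.ker (G.domRestrict (wpart d t))) := by
    rw [(Submodule.equivMapOfInjective V hV (wpart e t)).finrank_eq, hmapV,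
      ← (Submodule.comapSubtypeEquivOfLe inf_le_right).finrank_eq, Submodule.comap_inf,
      Submodule.comap_subtype_self, inf_top_eq]
    rfl
  have h2 := LinearMap.finrank_range_add_finrank_ker (G.domRestrict (wpart d t))
  rw [LinearMap.range_domRestrict, hmap, ← h1] at h2
  omega

theorem IsGradedRes.card_lt_card {J : Ideal (PR K n)} {p q : ℕ} {d : Fin q → ℕ} {e : Fin p → ℕ}
    {g : Fin q → PR K n} {v : Fin p → Fin q → PR K n} (h : IsGradedRes J d e g v) {t k : ℕ}
    (htk : t ≤ k) {x : PR K n} (hxJ : x ∈ J) (hx0 : x ≠ 0) (hxt : x.IsHomogeneous t) :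
    Fintype.card {i // e i ≤ k} < Fintype.card {j // d j ≤ k} := by
  obtain ⟨j₀, hj₀, hgj₀⟩ : ∃ j, d j ≤ k ∧ g j ≠ 0 := by
    by_contra! hcon
    rw [← h.span_gen, ← Ideal.submodule_span_eq, ← Fintype.range_linearCombination] at hxJ
    obtain ⟨a, rfl⟩ := hxJ
    refine hx0 ?_
    rw [← homogeneousComponent_eq_self hxt, ← linearCombination_wcomp h.homog_gen,
      Fintype.linearCombination_apply]
    refine Finset.sum_eq_zero fun j _ => ?_
    rw [wcomp_apply]
    split_ifs with hj
    · rw [hcon j (hj.trans htk), smul_zero]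
    · rw [zero_smul]
  have hgv : ∀ i, ∑ j, v i j * g j = 0 := fun i => by
    have : v i ∈ LinearMap.ker (Fintype.linearCombination (PR K n) g) :=
      h.span_syz ▸ Submodule.subset_span ⟨i, rfl⟩
    rwa [LinearMap.mem_ker, Fintype.linearCombination_apply] at this
  have hv0 : ∀ (i : {i // e i ≤ k}) (j : Fin q), ¬ d j ≤ k → v i j = 0 := fun i j hj => by
    have := wcomp_eq_self_iff.mp (h.homog_syz i) j
    rwa [if_neg (fun hji => hj (hji.trans i.2))] at this
  let w : Option {i // e i ≤ k} → {j // d j ≤ k} → PR K n := fun o =>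
    o.elim (Pi.single ⟨j₀, hj₀⟩ 1) fun i j => v i j
  have hw : LinearIndependent (PR K n) w := by
    rw [Fintype.linearIndependent_iff]
    intro a ha
    rw [Fintype.sum_option] at ha
    have hcoord : ∀ j : {j // d j ≤ k}, a none * (Pi.single ⟨j₀, hj₀⟩ 1 :
        {j // d j ≤ k} → PR K n) j + ∑ i : {i // e i ≤ k}, a (some i) * v i j = 0 := fun j => by
      have := congrFun ha j
      rw [Pi.add_apply, Pi.smul_apply, Finset.sum_apply] at this
      exact this
    have hnone : a none = 0 := by
      have h1 : ∑ j : {j // d j ≤ k}, (a none * (Pi.single ⟨j₀, hj₀⟩ 1 :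
        {j // d j ≤ k} → PR K n) j + ∑ i : {i // e i ≤ k}, a (some i) * v i j) * g j = 0 :=
        Finset.sum_eq_zero fun j _ => by rw [hcoord j, zero_mul]
      have h2 : ∀ i : {i // e i ≤ k}, ∑ j : {j // d j ≤ k}, v i j * g j = 0 := fun i => by
        rw [← hgv i]
        rw [← Finset.sum_subtype (Finset.univ.filter fun j => d j ≤ k) (by simp)
          (fun j => v i j * g j), Finset.sum_filter]
        refine Finset.sum_congr rfl fun j _ => ?_
        split_ifs with hj
        · rfl
        · rw [hv0 i j hj, zero_mul]
      simp only [add_mul, Finset.sum_add_distrib, Finset.sum_mul] at h1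
      rw [Finset.sum_comm] at h1
      simp only [mul_assoc, ← Finset.mul_sum, h2, mul_zero, Finset.sum_const_zero, add_zero] at h1
      rw [Finset.sum_eq_single ⟨j₀, hj₀⟩] at h1
      · simpa [hgj₀] using h1
      · intro b _ hb
        rw [Pi.single_eq_of_ne hb, zero_mul]
      · simp
    have hli := Fintype.linearIndependent_iff.mp
      (h.linearIndependent.comp (Subtype.val : {i // e i ≤ k} → Fin p) Subtype.val_injective)
      (fun i => a (some i)) (by
        ext1 j
        rw [Finset.sum_apply]
        by_cases hj : d j ≤ k
        · simpa [hnone] using hcoord ⟨j, hj⟩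
        · exact Finset.sum_eq_zero fun i _ => by simp [hv0 i j hj])
    rintro (_ | i)
    · exact hnone
    · exact hli i
  have hcard := hw.fintype_card_le_finrank
  rw [Module.finrank_fintype_fun_eq_card, Fintype.card_option] at hcard
  exact hcard

end Grading

theorem hPoly_sub_hPoly (n : ℕ) (k : ℤ) : hPoly (n + 1) k - hPoly (n + 1) (k - 1) = hPoly n k := by
  unfold hPoly
  obtain hk | rfl | hk := lt_trichotomy k 0
  · rw [if_pos hk, if_pos (by omega), if_pos hk, sub_zero]
  · simp
  · obtain ⟨t, rfl⟩ : ∃ t : ℕ, k = t + 1 := ⟨(k - 1).toNat, by omega⟩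
    rw [if_neg (by omega), if_neg (by omega), if_neg (by omega), add_sub_cancel_right,
      show ((t : ℤ) + 1).toNat = t + 1 by omega, Int.toNat_natCast,
      show n + 1 + (t + 1) = (n + (t + 1)) + 1 by omega, Nat.choose_succ_succ,
      show n + 1 + t = n + (t + 1) by omega]
    push_cast
    ring

/-- Two numerators with the same Hilbert function have the same partial sums of coefficients. -/
theorem card_sub_card_eq_of_hPoly {α β γ δ : Type} [Fintype α] [Fintype β] [Fintype γ] [Fintype δ]
    {r : α → ℤ} {s : β → ℤ} {d : γ → ℤ} {e : δ → ℤ} (n : ℕ)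
    (h : ∀ k, ∑ j, hPoly n (k - r j) - ∑ i, hPoly n (k - s i)
      = ∑ j, hPoly n (k - d j) - ∑ i, hPoly n (k - e i)) (k : ℤ) :
    (Fintype.card {j // r j ≤ k} : ℤ) - Fintype.card {i // s i ≤ k}
      = Fintype.card {j // d j ≤ k} - Fintype.card {i // e i ≤ k} := by
  induction n with
  | zero =>
    have hc : ∀ {ι : Type} [Fintype ι] (f : ι → ℤ),
        ∑ j, hPoly 0 (k - f j) = Fintype.card {j // f j ≤ k} := by
      intro ι _ f
      rw [Fintype.card_subtype, Finset.card_filter, Nat.cast_sum]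
      refine Finset.sum_congr rfl fun j _ => ?_
      by_cases hj : f j ≤ k
      · simp [hPoly, hj]
      · simp [hPoly, hj, not_le.mp hj]
    simpa only [hc] using h k
  | succ n ih =>
    refine ih fun k => ?_
    have h1 := h k
    have h2 := h (k - 1)
    have hc : ∀ {ι : Type} [Fintype ι] (f : ι → ℤ), ∑ j, hPoly n (k - f j)
        = ∑ j, hPoly (n + 1) (k - f j) - ∑ j, hPoly (n + 1) (k - 1 - f j) := by
      intro ι _ f
      rw [← Finset.sum_sub_distrib]
      refine Finset.sum_congr rfl fun j _ => ?_
      rw [← hPoly_sub_hPoly, sub_right_comm]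
    rw [hc, hc, hc, hc]
    linarith

theorem hPoly_nonneg (n : ℕ) (k : ℤ) : 0 ≤ hPoly n k := by
  unfold hPoly
  split_ifs <;> positivity

theorem exists_mem_of_hilbQuot_lt {K : Type} [Field K] {n : ℕ} {J : Ideal (PR K n)} {t : ℕ}
    (h : hilbQuot J t < hPoly n t) : ∃ x ∈ J, x ≠ 0 ∧ x.IsHomogeneous t := by
  unfold hilbQuot hPoly at h
  rw [if_neg (by omega), if_neg (by omega), Int.toNat_natCast,
    finrank_homogeneousSubmodule_fin] at h
  obtain ⟨x, hx⟩ := Module.finrank_pos_iff_exists_ne_zero.mp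
    (show 0 < Module.finrank K _ by exact_mod_cast (sub_lt_self_iff _).mp h)
  exact ⟨x, x.2.1, by simpa using hx, x.2.2⟩

theorem NumACM.le_of_hilbQuot_eq {K : Type} [Field K] {n : ℕ} {I : Ideal (PR K n)}
    (hI : NumACM I) {m : ℕ} {s : Fin (m + 1) → ℤ} {r : Fin (m + 2) → ℤ}
    (hs : Antitone s) (hr : Antitone r) (hrlast : 1 ≤ r (Fin.last (m + 1)))
    (hlast : r (Fin.last (m + 1)) < s (Fin.last m))
    (hhilb : ∀ k : ℤ, hilbQuot I k
      = hPoly n k - ∑ j, hPoly n (k - r j) + ∑ i, hPoly n (k - s i)) (i : Fin (m + 1)) :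
    r i.castSucc ≤ s i := by
  obtain ⟨J, -, hJ, -, hres, hJI⟩ := hI
  obtain ⟨p, q, d, e, g, v, h⟩ := exists_isGradedRes hJ hres
  by_contra! hlt
  have hsi : s (Fin.last m) ≤ s i := hs (Fin.le_last i)
  obtain ⟨t, ht⟩ : ∃ t : ℕ, r (Fin.last (m + 1)) = t := ⟨_, (Int.toNat_of_nonneg (by omega)).symm⟩
  obtain ⟨k, hk⟩ : ∃ k : ℕ, s i = k := ⟨_, (Int.toNat_of_nonneg (by omega)).symm⟩
  have hlow : hilbQuot J t < hPoly n t := by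
    rw [hJI, hhilb, Finset.sum_eq_zero (s := Finset.univ) (f := fun i => hPoly n (t - s i))]
    · have := Finset.single_le_sum (f := fun j => hPoly n (t - r j))
        (fun j _ => hPoly_nonneg _ _) (Finset.mem_univ (Fin.last (m + 1)))
      have h1 : hPoly n ((t : ℤ) - r (Fin.last (m + 1))) = 1 := by simp [ht, hPoly]
      linarith
    · intro j _
      have := hs (Fin.le_last j)
      exact if_pos (by omega)
  obtain ⟨x, hxJ, hx0, hxt⟩ := exists_mem_of_hilbQuot_lt hlow
  have hcard := h.card_lt_card (k := k) (by omega) hxJ hx0 hxt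
  have hnum := card_sub_card_eq_of_hPoly (r := r) (s := s) (d := fun j => (d j : ℤ))
    (e := fun i => (e i : ℤ)) n (fun k => by
      have h1 := h.hilbQuot_eq k
      rw [hJI, hhilb] at h1
      linarith) k
  simp only [Nat.cast_le] at hnum
  have hrcard : Fintype.card {j // r j ≤ k} ≤ m + 1 - i := by
    rw [Fintype.card_subtype]
    refine (Finset.card_le_card (t := Finset.Ioi i.castSucc) fun j hj => ?_).trans
      (by rw [Fin.card_Ioi]; simp)
    rw [Finset.mem_Ioi]
    by_contra! hji
    have := hr hji
    have := (Finset.mem_filter.mp hj).2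
    omega
  have hscard : m + 1 - i ≤ Fintype.card {i // s i ≤ k} := by
    rw [Fintype.card_subtype, ← Fin.card_Ici]
    refine Finset.card_le_card fun j hj => ?_
    have := hs (Finset.mem_Ici.mp hj)
    simp only [Finset.mem_filter, Finset.mem_univ, true_and]
    omega
  omega

/-- The products `a₀⋯a_{j-1} b_j⋯b_{l-1}`, which are up to sign the maximal minors of the bidiagonal
matrix with rows `bidiagonalSyz a b i`. -/
def bidiagonalGen {A : Type} [CommRing A] {l : ℕ} (a b : Fin l → A) (j : Fin (l + 1)) : A :=
  ∏ i, if i.castSucc < j then a i else b i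

/-- The rows of the bidiagonal matrix with entries `a i` and `-b i`. -/
def bidiagonalSyz {A : Type} [CommRing A] {l : ℕ} (a b : Fin l → A) (i : Fin l) : Fin (l + 1) → A :=
  Pi.single i.castSucc (a i) - Pi.single i.succ (b i)

section Bidiagonal

variable {A : Type} [CommRing A] {l : ℕ}

theorem bidiagonalGen_zero (a b : Fin l → A) : bidiagonalGen a b 0 = ∏ i, b i :=
  Finset.prod_congr rfl fun i _ => if_neg (by simp)

theorem bidiagonalGen_last (a b : Fin l → A) : bidiagonalGen a b (Fin.last l) = ∏ i, a i :=
  Finset.prod_congr rfl fun i _ => if_pos (Fin.castSucc_lt_last i)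

theorem bidiagonalGen_castSucc (a b : Fin (l + 1) → A) (j : Fin (l + 1)) :
    bidiagonalGen a b j.castSucc
      = bidiagonalGen (fun i => a i.castSucc) (fun i => b i.castSucc) j * b (Fin.last l) := by
  unfold bidiagonalGen
  rw [Fin.prod_univ_castSucc]
  congr 1
  · exact if_neg (by simpa [Fin.le_def] using Nat.le_of_lt_succ j.2)

theorem sum_bidiagonalSyz_mul (a b : Fin l → A) (i : Fin l) (x : Fin (l + 1) → A) :
    ∑ j, bidiagonalSyz a b i j * x j = a i * x i.castSucc - b i * x i.succ := by
  simp [bidiagonalSyz, sub_mul, Finset.sum_sub_distrib, Pi.single_apply]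

theorem bidiagonalSyz_relation (a b : Fin l → A) (i : Fin l) :
    ∑ j, bidiagonalSyz a b i j * bidiagonalGen a b j = 0 := by
  rw [sum_bidiagonalSyz_mul, sub_eq_zero]
  unfold bidiagonalGen
  rw [← Finset.mul_prod_erase _ _ (Finset.mem_univ i),
    ← Finset.mul_prod_erase (f := fun k => if k.castSucc < i.succ then a k else b k) _
      (Finset.mem_univ i), if_neg (lt_irrefl _), if_pos (by simp), mul_left_comm]
  congr 2
  refine Finset.prod_congr rfl fun k hk => ?_
  have hk : (k : ℕ) ≠ i := fun h => (Finset.mem_erase.mp hk).1 (Fin.ext h)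
  have : k.castSucc < i.castSucc ↔ k.castSucc < i.succ := by
    simp only [Fin.lt_def, Fin.val_castSucc, Fin.val_succ]
    omega
  simp only [this]

theorem bidiagonalSyz_castSucc (a b : Fin (l + 1) → A) (i : Fin l) :
    bidiagonalSyz a b i.castSucc
      = Fin.snoc (bidiagonalSyz (fun i => a i.castSucc) (fun i => b i.castSucc) i) 0 := by
  ext j
  refine Fin.lastCases ?_ (fun j => ?_) j
  · simp [bidiagonalSyz, Pi.single_apply, Fin.ext_iff]
    rw [if_neg (by omega), if_neg (by omega), sub_zero]
  · simp [bidiagonalSyz, Pi.single_apply, Fin.ext_iff]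

/-- The relations among the maximal minors of a bidiagonal matrix are generated by its rows. -/
theorem mem_span_bidiagonalSyz [IsDomain A] [DecompositionMonoid A] (a b : Fin l → A)
    (hb : ∀ i, b i ≠ 0) (hab : ∀ i k, IsRelPrime (b k) (a i)) (c : Fin (l + 1) → A)
    (hc : ∑ j, c j * bidiagonalGen a b j = 0) :
    c ∈ Submodule.span A (Set.range (bidiagonalSyz a b)) := by
  induction l with
  | zero =>
    have h0 : c 0 = 0 := by simpa [bidiagonalGen] using hc
    have : c = 0 := by
      ext j
      rw [Subsingleton.elim (α := Fin 1) j 0, h0, Pi.zero_apply]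
    rw [this]
    exact Submodule.zero_mem _
  | succ l ih =>
    obtain ⟨u, hu⟩ : b (Fin.last l) ∣ c (Fin.last (l + 1)) := by
      rw [Fin.sum_univ_castSucc, bidiagonalGen_last] at hc
      refine IsRelPrime.dvd_of_dvd_mul_right (z := ∏ i, a i)
        (IsRelPrime.prod_right fun i _ => hab i _) ?_
      rw [← dvd_add_right (a := b (Fin.last l)) (b := ∑ j : Fin (l + 1), c j.castSucc *
        bidiagonalGen a b j.castSucc) (Finset.dvd_sum fun j _ => ?_), hc]
      · exact dvd_zero _
      · rw [bidiagonalGen_castSucc]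
        exact ⟨c j.castSucc * bidiagonalGen (fun i => a i.castSucc) (fun i => b i.castSucc) j,
          by ring⟩
    set c' := c + u • bidiagonalSyz a b (Fin.last l) with hc'
    have hlast : c' (Fin.last (l + 1)) = 0 := by
      simp [hc', hu, bidiagonalSyz, mul_comm]
    have hrel : ∑ j, c' j * bidiagonalGen a b j = 0 := by
      simp only [hc', Pi.add_apply, Pi.smul_apply, smul_eq_mul, add_mul, Finset.sum_add_distrib,
        mul_assoc, ← Finset.mul_sum, hc, bidiagonalSyz_relation, mul_zero, add_zero]
    have hmem := ih (fun i => a i.castSucc) (fun i => b i.castSucc) (fun i => hb _)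
      (fun i k => hab _ _) (fun j => c' j.castSucc) (by
        rw [Fin.sum_univ_castSucc, hlast, zero_mul, add_zero] at hrel
        simp only [bidiagonalGen_castSucc, ← mul_assoc, ← Finset.sum_mul] at hrel
        exact (mul_eq_zero.mp hrel).resolve_right (hb _))
    obtain ⟨w, hw⟩ := (Submodule.mem_span_range_iff_exists_fun A).mp hmem
    have hc'mem : c' ∈ Submodule.span A (Set.range (bidiagonalSyz a b)) := by
      have : c' = ∑ i : Fin l, w i • bidiagonalSyz a b i.castSucc := by
        ext j
        rw [Finset.sum_apply]
        refine Fin.lastCases ?_ (fun j => ?_) j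
        · simp [hlast, bidiagonalSyz_castSucc]
        · simpa [bidiagonalSyz_castSucc] using (congrFun hw j).symm
      rw [this]
      exact Submodule.sum_mem _ fun i _ =>
        Submodule.smul_mem _ _ (Submodule.subset_span ⟨_, rfl⟩)
    rw [← add_sub_cancel_right c (u • bidiagonalSyz a b (Fin.last l)), ← hc']
    exact Submodule.sub_mem _ hc'mem (Submodule.smul_mem _ _ (Submodule.subset_span ⟨_, rfl⟩))

theorem linearIndependent_bidiagonalSyz [IsDomain A] (a b : Fin l → A) (hb : ∀ i, b i ≠ 0) :
    LinearIndependent A (bidiagonalSyz a b) := by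
  induction l with
  | zero => exact linearIndependent_empty_type
  | succ l ih =>
    rw [Fintype.linearIndependent_iff]
    intro w hw
    have hlast : w (Fin.last l) = 0 := by
      have := congrFun hw (Fin.last (l + 1))
      rw [Fin.sum_univ_castSucc] at this
      simpa [bidiagonalSyz_castSucc, bidiagonalSyz, hb] using this
    have hinit := Fintype.linearIndependent_iff.mp
      (ih (fun i => a i.castSucc) (fun i => b i.castSucc) fun i => hb _) (fun i => w i.castSucc) (by
        ext j
        have := congrFun hw j.castSucc
        rw [Fin.sum_univ_castSucc, hlast, zero_smul, add_zero] at this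
        simpa [bidiagonalSyz_castSucc] using this)
    exact fun i => Fin.lastCases hlast hinit i

end Bidiagonal

theorem sum_ite_castSucc_lt_eq {m : ℕ} {s : Fin (m + 1) → ℤ} {r : Fin (m + 2) → ℤ}
    (hsum : ∑ j, r j = ∑ i, s i) (j : Fin (m + 2)) :
    ∑ i : Fin (m + 1), (if i.castSucc < j then s i - r i.castSucc else s i - r i.succ) = r j := by
  have h : ∀ i : Fin (m + 1), (if i.castSucc < j then s i - r i.castSucc else s i - r i.succ)
      = s i - r (j.succAbove i) := fun i => by
    unfold Fin.succAbove
    split_ifs <;> rfl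
  rw [Finset.sum_congr rfl fun i _ => h i, Finset.sum_sub_distrib, ← hsum,
    Fin.sum_univ_succAbove r j, add_sub_cancel_right]

section Monomials

variable {K : Type} [Field K] {n : ℕ}

theorem wcomp_single {q : ℕ} {d : Fin q → ℕ} {t u : ℕ} {j : Fin q} {f : PR K n}
    (hf : f.IsHomogeneous u) (h : d j + u = t) : wcomp d t (Pi.single j f) = Pi.single j f := by
  rw [wcomp_eq_self_iff]
  intro i
  obtain rfl | hi := eq_or_ne i j
  · rw [if_pos (by omega), Pi.single_eq_same, show t - d i = u by omega]
    exact hf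
  · rw [Pi.single_eq_of_ne hi]
    split_ifs
    exacts [isHomogeneous_zero _ _ _, rfl]

theorem isRelPrime_X_pow {i j : Fin (n + 1)} (hij : i ≠ j) (a b : ℕ) :
    IsRelPrime (X i ^ a : PR K n) (X j ^ b) := by
  refine IsRelPrime.pow ?_
  rw [X_prime.irreducible.isRelPrime_iff_not_dvd, X_dvd_X]
  exact hij

theorem isGradedRes_bidiagonal {l : ℕ} (α β e : Fin l → ℕ) (d : Fin (l + 1) → ℕ)
    {x y : Fin (n + 1)} (hxy : x ≠ y)
    (hd : ∀ j, ∑ i : Fin l, (if i.castSucc < j then α i else β i) = d j)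
    (hα : ∀ i, d i.castSucc + α i = e i) (hβ : ∀ i, d i.succ + β i = e i) :
    IsGradedRes (K := K) (n := n)
      (Ideal.span (Set.range (bidiagonalGen (fun i => X x ^ α i) fun i => X y ^ β i))) d e
      (bidiagonalGen (fun i => X x ^ α i) fun i => X y ^ β i)
      (bidiagonalSyz (fun i => X x ^ α i) fun i => X y ^ β i) where
  homog_gen j := by
    rw [← hd j]
    refine IsHomogeneous.prod _ _ _ fun i _ => ?_
    split_ifs
    exacts [isHomogeneous_X_pow _ _, isHomogeneous_X_pow _ _]
  homog_syz i := by
    rw [bidiagonalSyz, map_sub, wcomp_single (isHomogeneous_X_pow _ _) (hα i),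
      wcomp_single (isHomogeneous_X_pow _ _) (hβ i)]
  span_gen := rfl
  linearIndependent := linearIndependent_bidiagonalSyz _ _ fun i => pow_ne_zero _ (X_ne_zero y)
  span_syz := by
    refine le_antisymm (Submodule.span_le.mpr ?_) fun c hc => ?_
    · rintro _ ⟨i, rfl⟩
      exact bidiagonalSyz_relation _ _ i
    · exact mem_span_bidiagonalSyz _ _ (fun i => pow_ne_zero _ (X_ne_zero y))
        (fun i k => isRelPrime_X_pow hxy.symm _ _) c hc

theorem idealHeight_eq_two {J : Ideal (PR K n)} {x y : Fin (n + 1)} (hxy : x ≠ y)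
    {a b : ℕ} (ha : X x ^ a ∈ J) (hb : X y ^ b ∈ J) (hJ : J ≤ Ideal.span {X x, X y}) :
    idealHeight J = 2 := by
  refine le_antisymm ?_ (le_iInf₂ fun P hP => ?_)
  · have hne : Ideal.span {X x, X y} ≠ (⊤ : Ideal (PR K n)) := by
      intro h
      have h1 : (1 : PR K n) ∈ Ideal.span {X x, X y} := h ▸ Submodule.mem_top
      obtain ⟨c, c', hc⟩ := Ideal.mem_span_pair.mp h1
      simpa using congrArg constantCoeff hc
    obtain ⟨P, hP⟩ := Ideal.nonempty_minimalPrimes hne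
    have hPp : P.IsPrime := hP.1.1
    refine (iInf₂_le (⟨P, hPp⟩ : PrimeSpectrum (PR K n)) (hJ.trans hP.1.2)).trans ?_
    rw [← PrimeSpectrum.height_eq_orderHeight]
    refine (Ideal.height_le_card_of_mem_minimalPrimes_span (Set.toFinite _) hP).trans ?_
    have h2 := Set.ncard_insert_le (X x : PR K n) {X y}
    rw [Set.ncard_singleton] at h2
    exact_mod_cast h2
  · have hPx : X x ∈ P.asIdeal := P.2.mem_of_pow_mem _ (hP ha)
    have hPy : X y ∈ P.asIdeal := P.2.mem_of_pow_mem _ (hP hb)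
    let Q : PrimeSpectrum (PR K n) :=
      ⟨Ideal.span {X x}, (Ideal.span_singleton_prime (X_ne_zero x)).mpr X_prime⟩
    let Z : PrimeSpectrum (PR K n) := ⟨⊥, Ideal.isPrime_bot⟩
    have hZQ : Z < Q := by
      rw [← PrimeSpectrum.asIdeal_lt_asIdeal, bot_lt_iff_ne_bot]
      exact Ideal.span_singleton_eq_bot.not.mpr (X_ne_zero x)
    have hQP : Q < P := by
      rw [← PrimeSpectrum.asIdeal_lt_asIdeal]
      refine lt_of_le_of_ne ((Ideal.span_singleton_le_iff_mem _).mpr hPx) fun h => hxy ?_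
      rw [← h, Ideal.mem_span_singleton, X_dvd_X] at hPy
      exact hPy
    calc (2 : ℕ∞) = 0 + 1 + 1 := by norm_num
      _ ≤ Order.height Z + 1 + 1 := by gcongr; exact zero_le
      _ ≤ Order.height Q + 1 := by gcongr; exact Order.height_add_one_le hZQ
      _ ≤ Order.height P := Order.height_add_one_le hQP

end Monomials

theorem numACM_of_le {K : Type} [Field K] {n : ℕ} (hn : 2 ≤ n) {I : Ideal (PR K n)}
    {m : ℕ} {s : Fin (m + 1) → ℤ} {r : Fin (m + 2) → ℤ} (hr : Antitone r)
    (hsum : ∑ j, r j = ∑ i, s i) (hrlast : 1 ≤ r (Fin.last (m + 1)))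
    (hhilb : ∀ k : ℤ, hilbQuot I k
      = hPoly n k - ∑ j, hPoly n (k - r j) + ∑ i, hPoly n (k - s i))
    (h : ∀ i : Fin (m + 1), r i.castSucc ≤ s i) : NumACM I := by
  have hr1 : ∀ j, 1 ≤ r j := fun j => hrlast.trans (hr (Fin.le_last j))
  have hsucc : ∀ i : Fin (m + 1), r i.succ ≤ s i := fun i =>
    (hr (Fin.castSucc_le_succ i)).trans (h i)
  have hs1 : ∀ i, 1 ≤ s i := fun i => (hr1 _).trans (h i)
  let x : Fin (n + 1) := 0
  let y : Fin (n + 1) := Fin.last n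
  have hxy : x ≠ y := by
    simp only [x, y, Ne, Fin.ext_iff, Fin.val_zero, Fin.val_last]
    omega
  let α : Fin (m + 1) → ℕ := fun i => (s i - r i.castSucc).toNat
  let β : Fin (m + 1) → ℕ := fun i => (s i - r i.succ).toNat
  have hd : ∀ j : Fin (m + 2),
      ∑ i : Fin (m + 1), (if i.castSucc < j then α i else β i) = (r j).toNat := fun j => by
    zify
    rw [Int.toNat_of_nonneg (by linarith [hr1 j]), ← sum_ite_castSucc_lt_eq hsum j]
    refine Finset.sum_congr rfl fun i _ => ?_
    split_ifs
    exacts [Int.toNat_of_nonneg (sub_nonneg.mpr (h i)),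
      Int.toNat_of_nonneg (sub_nonneg.mpr (hsucc i))]
  have hres := isGradedRes_bidiagonal (K := K) α β (fun i => (s i).toNat) (fun j => (r j).toNat) hxy
    hd (fun i => by have := h i; have := hr1 i.castSucc; simp only [α]; omega)
    (fun i => by have := hsucc i; have := hr1 i.succ; simp only [β]; omega)
  set g := bidiagonalGen (fun i => (X x ^ α i : PR K n)) fun i => X y ^ β i with hg
  have hJ : Ideal.span (Set.range g) ≤ Ideal.span {X x, X y} := by
    rw [Ideal.span_le]
    rintro _ ⟨j, rfl⟩
    obtain ⟨i, hi⟩ : ∃ i : Fin (m + 1), (if i.castSucc < j then α i else β i) ≠ 0 := by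
      by_contra! hcon
      have h1 := hd j
      have h2 := hr1 j
      rw [Finset.sum_eq_zero fun i _ => hcon i] at h1
      omega
    refine Ideal.mem_of_dvd _ (Finset.dvd_prod_of_mem _ (Finset.mem_univ i)) ?_
    split_ifs at hi ⊢
    · exact Ideal.pow_mem_of_mem _ (Ideal.subset_span (by simp)) _ (Nat.pos_of_ne_zero hi)
    · exact Ideal.pow_mem_of_mem _ (Ideal.subset_span (by simp)) _ (Nat.pos_of_ne_zero hi)
  have hht : idealHeight (Ideal.span (Set.range g)) = 2 := by
    refine idealHeight_eq_two hxy (a := ∑ i, α i) (b := ∑ i, β i) (Ideal.subset_span ⟨Fin.last _, ?_⟩)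
      (Ideal.subset_span ⟨0, ?_⟩) hJ
    · rw [hg, bidiagonalGen_last, Finset.prod_pow_eq_pow_sum]
    · rw [hg, bidiagonalGen_zero, Finset.prod_pow_eq_pow_sum]
  refine ⟨Ideal.span (Set.range g), ?_, hres.isHomogIdeal, hht, hres.hasLen1FreeRes, fun t => ?_⟩
  · intro htop
    have hempty : idealHeight (⊤ : Ideal (PR K n)) = ⊤ :=
      iInf₂_eq_top.mpr fun P hP => absurd (top_le_iff.mp hP) P.2.ne_top
    rw [htop, hempty] at hht
    exact ENat.top_ne_ofNat 2 hht
  · rw [hres.hilbQuot_eq, hhilb]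
    have hrc : ∀ j, ((r j).toNat : ℤ) = r j := fun j => Int.toNat_of_nonneg (by linarith [hr1 j])
    have hsc : ∀ i, ((s i).toNat : ℤ) = s i := fun i => Int.toNat_of_nonneg (by linarith [hs1 i])
    simp only [hrc, hsc]

theorem stmt9 {K : Type} [Field K] [Infinite K] {n : ℕ} (hn : 2 ≤ n)
    (I : Ideal (PR K n)) (hI : IsHomogIdeal I) (hIp : I ≠ ⊤) (hht : 2 ≤ idealHeight I)
    (m : ℕ) (s : Fin (m + 1) → ℤ) (r : Fin (m + 2) → ℤ)
    (hs : Antitone s) (hr : Antitone r)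
    (hsum : ∑ j, r j = ∑ i, s i)
    (hrlast : 1 ≤ r (Fin.last (m + 1)))
    (hlast : r (Fin.last (m + 1)) < s (Fin.last m))
    (hhilb : ∀ k : ℤ, hilbQuot I k
      = hPoly n k - ∑ j, hPoly n (k - r j) + ∑ i, hPoly n (k - s i)) :
    NumACM I ↔ ∀ i : Fin (m + 1), r i.castSucc ≤ s i := by
  exact ⟨fun h i => h.le_of_hilbQuot_eq hs hr hrlast hlast hhilb i,
    fun h => numACM_of_le hn hr hsum hrlast hhilb h⟩
end
end
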